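/- arXiv:1109.4473 — 5 statements merged into one kernel-verified Lean document; each statement's English description precedes it below -/
import Mathlib

section
/- For all positive integers n, r and nonnegative integer k, and every integer s with 0 ≤ s ≤ r, one has P(n+1, r, k+s) ≥ P(n, r, k). -/
/-- `numPart n r k` is the number of partitions of `k` into `r` distinct positive integers
each at most `n`, i.e. the number of `r`-element subsets of `{1, …, n}` summing to `k`. -/
def numPart (n r k : ℕ) : ℕ :=
  ((Finset.Icc 1 n).powerset.filter fun s => s.card = r ∧ s.sum id = k).card

theorem numPart_mono_left {m n : ℕ} (h : m ≤ n) (r k : ℕ) : numPart m r k ≤ numPart n r k :=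
  Finset.card_le_card <| Finset.filter_subset_filter _ <|
    Finset.powerset_mono.2 <| Finset.Icc_subset_Icc_right h

/-- Split the subsets counted by `numPart (n + 1) (r + 1) k` according to whether they contain
the largest admissible part `n + 1`. -/
theorem numPart_succ_succ (n r k : ℕ) :
    numPart (n + 1) (r + 1) k =
      numPart n (r + 1) k + if n + 1 ≤ k then numPart n r (k - (n + 1)) else 0 := by
  have hmem {t : Finset ℕ} (ht : t ∈ (Finset.Icc 1 n).powerset) : n + 1 ∉ t := fun h => by
    have := Finset.mem_Icc.1 (Finset.mem_powerset.1 ht h)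
    omega
  have hIcc : Finset.Icc 1 (n + 1) = insert (n + 1) (Finset.Icc 1 n) := by
    ext x
    simp only [Finset.mem_Icc, Finset.mem_insert]
    omega
  have hinj : Set.InjOn (insert (n + 1)) ((Finset.Icc 1 n).powerset : Set (Finset ℕ)) := by
    intro a ha b hb hab
    rw [← Finset.erase_insert (hmem ha), ← Finset.erase_insert (hmem hb)]
    exact congrArg (fun t => t.erase (n + 1)) hab
  unfold numPart
  rw [hIcc, Finset.powerset_insert, Finset.filter_union, Finset.card_union_of_disjoint]
  · congr 1
    rw [Finset.filter_image, Finset.card_image_of_injOn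
      (hinj.mono fun t ht => Finset.mem_of_mem_filter t ht)]
    split_ifs with hk
    · congr 1
      refine Finset.filter_congr fun t ht => ?_
      rw [Finset.card_insert_of_notMem (hmem ht), Finset.sum_insert (hmem ht)]
      simp only [id]
      omega
    · rw [Finset.card_eq_zero, Finset.filter_eq_empty_iff]
      rintro t ht ⟨-, h⟩
      rw [Finset.sum_insert (hmem ht)] at h
      simp only [id] at h
      omega
  · refine Finset.disjoint_left.2 fun t ht ht' => ?_
    obtain ⟨u, -, rfl⟩ := Finset.mem_image.1 (Finset.mem_of_mem_filter t ht')
    exact hmem (Finset.mem_of_mem_filter _ ht) (Finset.mem_insert_self _ _)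

theorem numPart_zero_succ (r k : ℕ) : numPart 0 (r + 1) k = 0 := by
  simp [numPart, Finset.filter_singleton]

theorem numPart_le_numPart_succ_add (n r k s : ℕ) (hs : s ≤ r) :
    numPart n r k ≤ numPart (n + 1) r (k + s) := by
  induction n generalizing r k s with
  | zero =>
    cases r with
    | zero =>
      obtain rfl : s = 0 := by omega
      exact numPart_mono_left (Nat.le_succ _) _ _
    | succ r => simp [numPart_zero_succ]
  | succ n ih =>
    cases s with
    | zero => exact numPart_mono_left (Nat.le_succ _) _ _
    | succ s =>
      obtain ⟨r, rfl⟩ : ∃ q, r = q + 1 := ⟨r - 1, by omega⟩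
      rw [numPart_succ_succ n, numPart_succ_succ (n + 1)]
      refine Nat.add_le_add (ih _ _ _ hs) ?_
      split_ifs with h₁ h₂
      · rw [show k + (s + 1) - (n + 1 + 1) = k - (n + 1) + s by omega]
        exact ih _ _ _ (by omega)
      · omega
      · exact Nat.zero_le _
      · exact le_rfl

/-- For all positive integers `n, r`, every `k ≥ 0` and every `s` with `0 ≤ s ≤ r`,
one has `P(n+1, r, k+s) ≥ P(n, r, k)`. -/
theorem numPart_succ_ge (n r k s : ℕ) (hn : 0 < n) (hr : 0 < r) (hs : s ≤ r) :
    numPart (n + 1) r (k + s) ≥ numPart n r k :=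
  numPart_le_numPart_succ_add n r k s hs
end

section
/- For every positive integer n and every r with 0 ≤ r ≤ n, the rank of the kernel of the endomorphism ∧^r S_n − id of the r-th exterior power Λ^r ℤ^n (a free abelian group of rank C(n,r)) equals P(n, r, ⌊r(n+1)/2⌋), where ∧^r S_n denotes the r-th exterior power of the automorphism of ℤ^n given by the matrix S_n. -/
open ExteriorAlgebra

/-- The endomorphism of the `r`-th exterior power `Λ^r M` induced by an endomorphism of `M`. -/
noncomputable def extPowMap {R : Type*} [CommRing R] {M : Type*} [AddCommGroup M] [Module R M]
    (r : ℕ) (f : M →ₗ[R] M) : (⋀[R]^r M) →ₗ[R] (⋀[R]^r M) :=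
  LinearMap.restrict (ExteriorAlgebra.map f).toLinearMap (fun x hx => by
    rw [← ExteriorAlgebra.ιMulti_span_fixedDegree] at hx ⊢
    induction hx using Submodule.span_induction with
    | mem y hy =>
      obtain ⟨m, rfl⟩ := hy
      rw [AlgHom.toLinearMap_apply, ExteriorAlgebra.map_apply_ιMulti]
      exact Submodule.subset_span ⟨f ∘ m, rfl⟩
    | zero => simp
    | add y z _ _ hy hz => rw [map_add]; exact Submodule.add_mem _ hy hz
    | smul c y _ hy => rw [map_smul]; exact Submodule.smul_mem _ c hy)

/-- The `n × n` integer matrix `S_n`: the full unipotent Jordan block with `1`'s on the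
diagonal and the superdiagonal, and `0`'s elsewhere. -/
def jordanS (n : ℕ) : Matrix (Fin n) (Fin n) ℤ :=
  Matrix.of fun i j => if (j : ℕ) = (i : ℕ) ∨ (j : ℕ) = (i : ℕ) + 1 then 1 else 0

namespace JordanExtPow

variable {m r : ℕ}

/-- Exchanging the positions `i` and `i + 1` in an `r`-element subset of `{0, …, m}`. -/
def swapAt (i : Fin m) (s : Set.powersetCard (Fin (m + 1)) r) :
    Set.powersetCard (Fin (m + 1)) r :=
  Set.powersetCard.map r (Equiv.swap i.castSucc i.succ).toEmbedding s

lemma mem_swapAt (i : Fin m) (s : Set.powersetCard (Fin (m + 1)) r) (a : Fin (m + 1)) :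
    a ∈ swapAt i s ↔ Equiv.swap i.castSucc i.succ a ∈ s := by
  rw [← Set.powersetCard.mem_coe_iff, ← Set.powersetCard.mem_coe_iff, swapAt,
    Set.powersetCard.val_map, Finset.mem_map_equiv, Equiv.symm_swap]

@[simp]
lemma castSucc_mem_swapAt (i : Fin m) (s : Set.powersetCard (Fin (m + 1)) r) :
    i.castSucc ∈ swapAt i s ↔ i.succ ∈ s := by
  simp [mem_swapAt]

@[simp]
lemma succ_mem_swapAt (i : Fin m) (s : Set.powersetCard (Fin (m + 1)) r) :
    i.succ ∈ swapAt i s ↔ i.castSucc ∈ s := by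
  simp [mem_swapAt]

@[simp]
lemma swapAt_swapAt (i : Fin m) (s : Set.powersetCard (Fin (m + 1)) r) :
    swapAt i (swapAt i s) = s := by
  apply SetLike.ext
  simp [mem_swapAt]

/-- `swapAt` as a permutation. -/
def swapAtEquiv (i : Fin m) : Equiv.Perm (Set.powersetCard (Fin (m + 1)) r) :=
  Function.Involutive.toPerm (swapAt i) (swapAt_swapAt i)

@[simp]
lemma swapAtEquiv_apply (i : Fin m) (s : Set.powersetCard (Fin (m + 1)) r) :
    swapAtEquiv i s = swapAt i s := rfl

lemma prod_swapAt {M : Type*} [CommMonoid M] (f : Fin (m + 1) → M) (i : Fin m)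
    (s : Set.powersetCard (Fin (m + 1)) r) :
    ∏ a ∈ (swapAt i s).val, f a = ∏ a ∈ s.val, f (Equiv.swap i.castSucc i.succ a) := by
  simp [swapAt]

/-- The matrix unit `e_{i+1} ↦ e_i` acting as a derivation on the exterior power, in
coordinates. -/
noncomputable def lower (i : Fin m) :
    (Set.powersetCard (Fin (m + 1)) r → ℤ) →ₗ[ℤ] (Set.powersetCard (Fin (m + 1)) r → ℤ) where
  toFun v s := open Classical in
    if i.castSucc ∈ s ∧ i.succ ∉ s then v (swapAt i s) else 0
  map_add' v w := by ext s; simp only [Pi.add_apply]; split_ifs <;> simp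
  map_smul' c v := by ext s; simp

/-- The matrix unit `e_i ↦ e_{i+1}` acting as a derivation on the exterior power, in
coordinates. -/
noncomputable def raise (i : Fin m) :
    (Set.powersetCard (Fin (m + 1)) r → ℤ) →ₗ[ℤ] (Set.powersetCard (Fin (m + 1)) r → ℤ) where
  toFun v s := open Classical in
    if i.castSucc ∉ s ∧ i.succ ∈ s then v (swapAt i s) else 0
  map_add' v w := by ext s; simp only [Pi.add_apply]; split_ifs <;> simp
  map_smul' c v := by ext s; simp

open Classical in
lemma lower_apply (i : Fin m) (v : Set.powersetCard (Fin (m + 1)) r → ℤ)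
    (s : Set.powersetCard (Fin (m + 1)) r) :
    lower i v s = if i.castSucc ∈ s ∧ i.succ ∉ s then v (swapAt i s) else 0 := rfl

open Classical in
lemma raise_apply (i : Fin m) (v : Set.powersetCard (Fin (m + 1)) r → ℤ)
    (s : Set.powersetCard (Fin (m + 1)) r) :
    raise i v s = if i.castSucc ∉ s ∧ i.succ ∈ s then v (swapAt i s) else 0 := rfl

lemma lower_raise_comm {i j : Fin m} (hij : i ≠ j)
    (v : Set.powersetCard (Fin (m + 1)) r → ℤ) :
    lower i (raise j v) = raise j (lower i v) := by
  ext s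
  have h1 : i.castSucc ≠ j.castSucc := by simpa using hij
  have h2 : i.succ ≠ j.succ := by simpa using hij
  rw [lower_apply, raise_apply, raise_apply, lower_apply, mem_swapAt i s, mem_swapAt i s,
    mem_swapAt j s, mem_swapAt j s]
  by_cases h5 : i.succ = j.castSucc
  · have h7 : Equiv.swap i.castSucc i.succ j.castSucc = i.castSucc := by
      rw [← h5, Equiv.swap_apply_right]
    have h8 : Equiv.swap j.castSucc j.succ i.succ = j.succ := by
      rw [h5, Equiv.swap_apply_left]
    rw [h7, h8]
    split_ifs <;> tauto
  by_cases h6 : i.castSucc = j.succ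
  · have h7 : Equiv.swap i.castSucc i.succ j.succ = i.succ := by
      rw [← h6, Equiv.swap_apply_left]
    have h8 : Equiv.swap j.castSucc j.succ i.castSucc = j.castSucc := by
      rw [h6, Equiv.swap_apply_right]
    rw [h7, h8]
    split_ifs <;> tauto
  · have hs : swapAt j (swapAt i s) = swapAt i (swapAt j s) := by
      apply SetLike.ext
      intro a
      have : Equiv.Perm.Disjoint (Equiv.swap i.castSucc i.succ)
          (Equiv.swap j.castSucc j.succ) := by
        intro b
        by_cases hb : b = i.castSucc ∨ b = i.succ
        · right
          rcases hb with rfl | rfl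
          · rw [Equiv.swap_apply_of_ne_of_ne h1 h6]
          · rw [Equiv.swap_apply_of_ne_of_ne h5 h2]
        · left
          push Not at hb
          rw [Equiv.swap_apply_of_ne_of_ne hb.1 hb.2]
      have := congrArg (fun p => p a) this.commute.eq
      simp only [Equiv.Perm.mul_apply] at this
      rw [mem_swapAt, mem_swapAt, mem_swapAt, mem_swapAt, this]
    rw [hs, Equiv.swap_apply_of_ne_of_ne (Ne.symm h1) (Ne.symm h5),
      Equiv.swap_apply_of_ne_of_ne (Ne.symm h6) (Ne.symm h2),
      Equiv.swap_apply_of_ne_of_ne h1 h6, Equiv.swap_apply_of_ne_of_ne h5 h2]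
    split_ifs <;> tauto

open Classical in
lemma lower_raise_self (i : Fin m) (v : Set.powersetCard (Fin (m + 1)) r → ℤ)
    (s : Set.powersetCard (Fin (m + 1)) r) :
    lower i (raise i v) s = raise i (lower i v) s +
      ((if i.castSucc ∈ s then 1 else 0) - (if i.succ ∈ s then 1 else 0)) * v s := by
  simp only [lower_apply, raise_apply, castSucc_mem_swapAt, succ_mem_swapAt, swapAt_swapAt]
  by_cases h1 : i.castSucc ∈ s <;> by_cases h2 : i.succ ∈ s <;> simp [h1, h2]

/-- The lowering operator. -/
noncomputable def lowering (m r : ℕ) :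
    (Set.powersetCard (Fin (m + 1)) r → ℤ) →ₗ[ℤ] (Set.powersetCard (Fin (m + 1)) r → ℤ) :=
  ∑ i : Fin m, lower i

/-- The raising operator completing `lowering` to an `𝔰𝔩₂`-triple. -/
noncomputable def raising (m r : ℕ) :
    (Set.powersetCard (Fin (m + 1)) r → ℤ) →ₗ[ℤ] (Set.powersetCard (Fin (m + 1)) r → ℤ) :=
  ∑ i : Fin m, (((i : ℤ) + 1) * (m - i)) • raise i

/-- The sum of the elements of a subset of `{0, …, m}`, shifted to `{1, …, m + 1}`. -/
def weight (s : Set.powersetCard (Fin (m + 1)) r) : ℕ :=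
  ∑ a ∈ s.val, ((a : ℕ) + 1)

open Classical in
lemma sum_coeff_sub (s : Set.powersetCard (Fin (m + 1)) r) :
    ∑ i : Fin m, (((i : ℤ) + 1) * (m - i)) *
      ((if i.castSucc ∈ s then 1 else 0) - (if i.succ ∈ s then 1 else 0)) =
    (r * (m + 2) : ℤ) - 2 * weight s := by
  have e1 : ∑ i : Fin m, (((i : ℤ) + 1) * (m - i)) * (if i.castSucc ∈ s then 1 else 0) =
      ∑ a : Fin (m + 1), (((a : ℤ) + 1) * (m - a)) * (if a ∈ s then 1 else 0) := by
    rw [Fin.sum_univ_castSucc]; simp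
  have e2 : ∑ i : Fin m, (((i : ℤ) + 1) * (m - i)) * (if i.succ ∈ s then 1 else 0) =
      ∑ a : Fin (m + 1), ((a : ℤ) * (m + 1 - a)) * (if a ∈ s then 1 else 0) := by
    rw [Fin.sum_univ_succ]; simp
  have e3 : (r * (m + 2) : ℤ) - 2 * weight s = ∑ a ∈ s.val, ((m : ℤ) - 2 * a) := by
    have : (s.val.card : ℤ) = r := by exact_mod_cast s.prop
    simp only [weight, Finset.sum_sub_distrib, Finset.sum_const, nsmul_eq_mul, mul_one,
      Nat.cast_sum, Nat.cast_add, Finset.sum_add_distrib, ← Finset.mul_sum, Nat.cast_id, this]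
    ring
  have e4 : ∑ a ∈ s.val, ((m : ℤ) - 2 * a) =
      ∑ a : Fin (m + 1), ((m : ℤ) - 2 * a) * (if a ∈ s then 1 else 0) := by
    simp only [mul_ite, mul_one, mul_zero, ← Set.powersetCard.mem_coe_iff]
    rw [Finset.sum_ite_mem, Finset.univ_inter]
  rw [Finset.sum_congr rfl fun i _ => mul_sub _ _ _, Finset.sum_sub_distrib, e1, e2, e3, e4,
    ← Finset.sum_sub_distrib]
  exact Finset.sum_congr rfl fun a _ => by ring

lemma lowering_raising (v : Set.powersetCard (Fin (m + 1)) r → ℤ)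
    (s : Set.powersetCard (Fin (m + 1)) r) :
    lowering m r (raising m r v) s = raising m r (lowering m r v) s +
      ((r * (m + 2) : ℤ) - 2 * weight s) * v s := by
  classical
  have key : ∀ i j : Fin m, lower i (raise j v) s = raise j (lower i v) s +
      if i = j then
        ((if j.castSucc ∈ s then 1 else 0) - (if j.succ ∈ s then 1 else 0)) * v s else 0 := by
    intro i j
    by_cases h : i = j
    · subst h
      rw [if_pos rfl, lower_raise_self]
    · rw [if_neg h, lower_raise_comm h, add_zero]
  have hl : lowering m r (raising m r v) s =
      ∑ j : Fin m, ∑ i : Fin m, (((j : ℤ) + 1) * (m - j)) * lower i (raise j v) s := by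
    simp only [lowering, raising, LinearMap.sum_apply, map_sum, LinearMap.smul_apply, map_smul,
      Finset.sum_apply, Pi.smul_apply, smul_eq_mul, Finset.mul_sum]
  have hr : raising m r (lowering m r v) s =
      ∑ j : Fin m, ∑ i : Fin m, (((j : ℤ) + 1) * (m - j)) * raise j (lower i v) s := by
    simp only [lowering, raising, LinearMap.sum_apply, map_sum, LinearMap.smul_apply,
      Finset.sum_apply, Pi.smul_apply, smul_eq_mul]
    rw [Finset.sum_comm]
  rw [hl, hr, ← sum_coeff_sub, Finset.sum_mul, ← Finset.sum_add_distrib]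
  refine Finset.sum_congr rfl fun j _ => ?_
  rw [Finset.sum_congr rfl fun i _ => by rw [key, mul_add], Finset.sum_add_distrib]
  congr 1
  simp [mul_assoc]

/-- Squared lengths of the coordinate vectors for which `lowering` and `raising` are adjoint. -/
def sqLen (s : Set.powersetCard (Fin (m + 1)) r) : ℤ :=
  ∏ a ∈ s.val, ∏ j ∈ Finset.Ico (a : ℕ) m, (((j : ℤ) + 1) * (m - j))

lemma sqLen_pos (s : Set.powersetCard (Fin (m + 1)) r) : 0 < sqLen s := by
  refine Finset.prod_pos fun a _ => Finset.prod_pos fun j hj => ?_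
  have : (j : ℤ) < m := by exact_mod_cast (Finset.mem_Ico.mp hj).2
  exact mul_pos (by positivity) (by linarith)

lemma sqLen_swapAt (i : Fin m) (s : Set.powersetCard (Fin (m + 1)) r)
    (h1 : i.castSucc ∉ s) (h2 : i.succ ∈ s) :
    sqLen (swapAt i s) = (((i : ℤ) + 1) * (m - i)) * sqLen s := by
  rw [← Set.powersetCard.mem_coe_iff] at h1 h2
  rw [sqLen, prod_swapAt, sqLen, ← Finset.mul_prod_erase _ _ h2, ← Finset.mul_prod_erase _ _ h2,
    Equiv.swap_apply_right, Fin.val_castSucc, Finset.prod_eq_prod_Ico_succ_bot i.isLt,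
    Fin.val_succ, mul_assoc]
  congr 2
  refine Finset.prod_congr rfl fun a ha => ?_
  obtain ⟨ha1, ha2⟩ := Finset.mem_erase.mp ha
  rw [Equiv.swap_apply_of_ne_of_ne (by rintro rfl; exact h1 ha2) ha1]

lemma sum_sqLen_lower (i : Fin m) (x y : Set.powersetCard (Fin (m + 1)) r → ℤ) :
    ∑ s, sqLen s * lower i x s * y s =
      ∑ s, sqLen s * x s * ((((i : ℤ) + 1) * (m - i)) * raise i y s) := by
  rw [← Equiv.sum_comp (swapAtEquiv i)]
  refine Finset.sum_congr rfl fun s _ => ?_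
  rw [swapAtEquiv_apply, lower_apply, raise_apply, castSucc_mem_swapAt, succ_mem_swapAt,
    swapAt_swapAt]
  by_cases h : i.castSucc ∉ s ∧ i.succ ∈ s
  · rw [if_pos h.symm, if_pos h, sqLen_swapAt i s h.1 h.2]
    ring
  · rw [if_neg (mt And.symm h), if_neg h]
    ring

lemma sum_sqLen_lowering (x y : Set.powersetCard (Fin (m + 1)) r → ℤ) :
    ∑ s, sqLen s * lowering m r x s * y s = ∑ s, sqLen s * x s * raising m r y s := by
  simp only [lowering, raising, LinearMap.sum_apply, LinearMap.smul_apply,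
    Finset.sum_apply, Pi.smul_apply, smul_eq_mul, Finset.mul_sum, Finset.sum_mul]
  rw [Finset.sum_comm, Finset.sum_congr rfl fun i _ => sum_sqLen_lower i x y, Finset.sum_comm]

lemma sum_sqLen_lowering_sq (x : Set.powersetCard (Fin (m + 1)) r → ℤ) :
    ∑ s, sqLen s * lowering m r x s ^ 2 +
        ∑ s, sqLen s * ((r * (m + 2) : ℤ) - 2 * weight s) * x s ^ 2 =
      ∑ s, sqLen s * raising m r x s ^ 2 := by
  have h1 : ∑ s, sqLen s * lowering m r x s ^ 2 =
      ∑ s, sqLen s * x s * raising m r (lowering m r x) s := by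
    rw [← sum_sqLen_lowering]
    exact Finset.sum_congr rfl fun s _ => by ring
  have h2 : ∑ s, sqLen s * raising m r x s ^ 2 =
      ∑ s, sqLen s * lowering m r (raising m r x) s * x s := by
    rw [sum_sqLen_lowering]
    exact Finset.sum_congr rfl fun s _ => by ring
  rw [h1, h2, ← Finset.sum_add_distrib]
  exact Finset.sum_congr rfl fun s _ => by rw [lowering_raising]; ring

lemma eq_zero_of_sum_sqLen_sq (x : Set.powersetCard (Fin (m + 1)) r → ℤ)
    (h : ∑ s, sqLen s * x s ^ 2 ≤ 0) : x = 0 := by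
  have hn : ∀ s ∈ Finset.univ, 0 ≤ sqLen s * x s ^ 2 :=
    fun s _ => mul_nonneg (sqLen_pos s).le (sq_nonneg _)
  have h0 := (Finset.sum_eq_zero_iff_of_nonneg hn).mp (le_antisymm h (Finset.sum_nonneg hn))
  ext s
  simpa [(sqLen_pos s).ne'] using h0 s (Finset.mem_univ s)

/-- `lowering` is injective above the middle weight. -/
lemma eq_zero_of_lowering_eq_zero {x : Set.powersetCard (Fin (m + 1)) r → ℤ} {k : ℕ}
    (hx : ∀ s, x s ≠ 0 → weight s = k) (hk : r * (m + 2) < 2 * k) (h : lowering m r x = 0) :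
    x = 0 := by
  have e := sum_sqLen_lowering_sq x
  have hk' : ((r * (m + 2) : ℤ) - 2 * k) < 0 := by
    have : (r * (m + 2) : ℤ) < 2 * k := by exact_mod_cast hk
    linarith
  have h1 : ∑ s, sqLen s * ((r * (m + 2) : ℤ) - 2 * weight s) * x s ^ 2 =
      ((r * (m + 2) : ℤ) - 2 * k) * ∑ s, sqLen s * x s ^ 2 := by
    rw [Finset.mul_sum]
    refine Finset.sum_congr rfl fun s _ => ?_
    by_cases h0 : x s = 0
    · simp [h0]
    · rw [hx s h0]; ring
  have h2 : 0 ≤ ∑ s, sqLen s * raising m r x s ^ 2 :=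
    Finset.sum_nonneg fun s _ => mul_nonneg (sqLen_pos s).le (sq_nonneg _)
  rw [h1] at e
  simp only [h, Pi.zero_apply, ne_eq, OfNat.ofNat_ne_zero, not_false_eq_true, zero_pow, mul_zero,
    Finset.sum_const_zero, zero_add] at e
  exact eq_zero_of_sum_sqLen_sq x (by nlinarith)

/-- `raising` is injective below the middle weight. -/
lemma eq_zero_of_lowering_raising_eq_zero {x : Set.powersetCard (Fin (m + 1)) r → ℤ} {k : ℕ}
    (hx : ∀ s, x s ≠ 0 → weight s = k) (hk : 2 * k < r * (m + 2))
    (h : lowering m r (raising m r x) = 0) : x = 0 := by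
  have e := sum_sqLen_lowering_sq x
  have hk' : 0 < ((r * (m + 2) : ℤ) - 2 * k) := by
    have : 2 * k < (r * (m + 2) : ℤ) := by exact_mod_cast hk
    linarith
  have h1 : ∑ s, sqLen s * ((r * (m + 2) : ℤ) - 2 * weight s) * x s ^ 2 =
      ((r * (m + 2) : ℤ) - 2 * k) * ∑ s, sqLen s * x s ^ 2 := by
    rw [Finset.mul_sum]
    refine Finset.sum_congr rfl fun s _ => ?_
    by_cases h0 : x s = 0
    · simp [h0]
    · rw [hx s h0]; ring
  have h2 : 0 ≤ ∑ s, sqLen s * lowering m r x s ^ 2 :=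
    Finset.sum_nonneg fun s _ => mul_nonneg (sqLen_pos s).le (sq_nonneg _)
  have h3 : ∑ s, sqLen s * raising m r x s ^ 2 = 0 := by
    have := sum_sqLen_lowering (raising m r x) x
    simp only [h, Pi.zero_apply, mul_zero, zero_mul, Finset.sum_const_zero] at this
    rw [this]
    exact Finset.sum_congr rfl fun s _ => by ring
  rw [h1, h3] at e
  exact eq_zero_of_sum_sqLen_sq x (by nlinarith)

lemma weight_swapAt (i : Fin m) (s : Set.powersetCard (Fin (m + 1)) r)
    (h1 : i.castSucc ∈ s) (h2 : i.succ ∉ s) : weight (swapAt i s) = weight s + 1 := by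
  rw [← Set.powersetCard.mem_coe_iff] at h1 h2
  have e : weight (swapAt i s) =
      ∑ a ∈ s.val, ((Equiv.swap i.castSucc i.succ a : Fin (m + 1)) + 1 : ℕ) := by
    simp [weight, swapAt]
  have e' : ∑ a ∈ s.val.erase i.castSucc,
      ((Equiv.swap i.castSucc i.succ a : Fin (m + 1)) + 1 : ℕ) =
      ∑ a ∈ s.val.erase i.castSucc, ((a : ℕ) + 1) := by
    refine Finset.sum_congr rfl fun a ha => ?_
    obtain ⟨ha1, ha2⟩ := Finset.mem_erase.mp ha
    rw [Equiv.swap_apply_of_ne_of_ne ha1 (by rintro rfl; exact h2 ha2)]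
  rw [e, weight, ← Finset.add_sum_erase _ _ h1, ← Finset.add_sum_erase _ _ h1, e',
    Equiv.swap_apply_left, Fin.val_succ, Fin.val_castSucc]
  ring

/-- The vectors supported in weights less than `k`. -/
def weightLT (m r k : ℕ) : Submodule ℤ (Set.powersetCard (Fin (m + 1)) r → ℤ) where
  carrier := {x | ∀ s, k ≤ weight s → x s = 0}
  add_mem' hx hy s hs := by simp [hx s hs, hy s hs]
  zero_mem' s _ := rfl
  smul_mem' c x hx s hs := by simp [hx s hs]

lemma weightLT_mono {k l : ℕ} (h : k ≤ l) : weightLT m r k ≤ weightLT m r l :=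
  fun _ hx s hs => hx s (h.trans hs)

lemma lower_mem {k : ℕ} (i : Fin m) {x : Set.powersetCard (Fin (m + 1)) r → ℤ}
    (hx : x ∈ weightLT m r k) : lower i x ∈ weightLT m r (k - 1) := by
  intro s hs
  rw [lower_apply]
  split_ifs with h
  · exact hx _ (by rw [weight_swapAt i s h.1 h.2]; omega)
  · rfl

lemma raise_mem {k : ℕ} (i : Fin m) {x : Set.powersetCard (Fin (m + 1)) r → ℤ}
    (hx : x ∈ weightLT m r k) : raise i x ∈ weightLT m r (k + 1) := by
  intro s hs
  rw [raise_apply]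
  split_ifs with h
  · have := weight_swapAt i (swapAt i s) (by simpa using h.2) (by simpa using h.1)
    rw [swapAt_swapAt] at this
    exact hx _ (by omega)
  · rfl

lemma lowering_mem {k : ℕ} {x : Set.powersetCard (Fin (m + 1)) r → ℤ}
    (hx : x ∈ weightLT m r k) : lowering m r x ∈ weightLT m r (k - 1) := by
  rw [lowering, LinearMap.sum_apply]
  exact Submodule.sum_mem _ fun i _ => lower_mem i hx

lemma raising_mem {k : ℕ} {x : Set.powersetCard (Fin (m + 1)) r → ℤ}
    (hx : x ∈ weightLT m r k) : raising m r x ∈ weightLT m r (k + 1) := by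
  rw [raising, LinearMap.sum_apply]
  exact Submodule.sum_mem _ fun i _ => Submodule.smul_mem _ _ (raise_mem i hx)

/-- The component of weight `k` of a vector. -/
def component (k : ℕ) (x : Set.powersetCard (Fin (m + 1)) r → ℤ) :
    Set.powersetCard (Fin (m + 1)) r → ℤ :=
  fun s => if weight s = k then x s else 0

lemma component_eq_zero_of_mem {k : ℕ} {x : Set.powersetCard (Fin (m + 1)) r → ℤ}
    (hx : x ∈ weightLT m r k) : component k x = 0 := by
  ext s
  by_cases h : weight s = k
  · simp [component, hx s h.ge]
  · simp [component, h]

lemma mem_of_component_eq_zero {k : ℕ} {x : Set.powersetCard (Fin (m + 1)) r → ℤ}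
    (hx : x ∈ weightLT m r (k + 1)) (h : component k x = 0) : x ∈ weightLT m r k := by
  intro s hs
  rcases hs.eq_or_lt with hs | hs
  · simpa [component, hs.symm] using congrFun h s
  · exact hx s hs

lemma weight_eq_of_component_ne_zero {k : ℕ} {x : Set.powersetCard (Fin (m + 1)) r → ℤ}
    {s : Set.powersetCard (Fin (m + 1)) r} (h : component k x s ≠ 0) : weight s = k := by
  by_contra h'
  exact h (if_neg h')

lemma lowering_component (k : ℕ) (x : Set.powersetCard (Fin (m + 1)) r → ℤ) :
    lowering m r (component (k + 1) x) = component k (lowering m r x) := by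
  have key (i : Fin m) (s) : lower i (component (k + 1) x) s =
      if weight s = k then lower i x s else 0 := by
    rw [lower_apply, lower_apply]
    by_cases h : i.castSucc ∈ s ∧ i.succ ∉ s
    · rw [if_pos h, if_pos h, component, weight_swapAt i s h.1 h.2]
      simp
    · rw [if_neg h, if_neg h, ite_self]
  ext s
  simp only [lowering, LinearMap.sum_apply, Finset.sum_apply, component, key]
  split_ifs <;> simp

lemma raising_component (k : ℕ) (x : Set.powersetCard (Fin (m + 1)) r → ℤ) :
    raising m r (component k x) = component (k + 1) (raising m r x) := by
  have key (i : Fin m) (s) : raise i (component k x) s =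
      if weight s = k + 1 then raise i x s else 0 := by
    rw [raise_apply, raise_apply]
    by_cases h : i.castSucc ∉ s ∧ i.succ ∈ s
    · have := weight_swapAt i (swapAt i s) (by simpa using h.2) (by simpa using h.1)
      rw [swapAt_swapAt] at this
      rw [if_pos h, if_pos h, component, this]
      simp
    · rw [if_neg h, if_neg h, ite_self]
  ext s
  simp only [raising, LinearMap.sum_apply, Finset.sum_apply, component, LinearMap.smul_apply,
    Pi.smul_apply, key]
  split_ifs <;> simp

lemma weightLT_zero : weightLT m r 0 = ⊥ :=
  eq_bot_iff.mpr fun _ hx => (Submodule.mem_bot ℤ).mpr (funext fun s => hx s (Nat.zero_le _))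

lemma finrank_weightLT (k : ℕ) :
    Module.finrank ℤ (weightLT m r k) =
      Nat.card {s : Set.powersetCard (Fin (m + 1)) r // weight s < k} := by
  let e : weightLT m r k ≃ₗ[ℤ]
      ({s : Set.powersetCard (Fin (m + 1)) r // weight s < k} → ℤ) :=
    { toFun := fun x s => x.1 s.1
      map_add' := fun _ _ => rfl
      map_smul' := fun _ _ => rfl
      invFun := fun y => ⟨fun s => if h : weight s < k then y ⟨s, h⟩ else 0,
        fun s hs => dif_neg hs.not_gt⟩
      left_inv := fun x => by
        ext s
        by_cases h : weight s < k
        · simp [h]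
        · simp [h, x.2 s (not_lt.mp h)]
      right_inv := fun y => by
        ext s
        simp [s.2] }
  rw [e.finrank_eq, Module.finrank_fintype_fun_eq_card, Nat.card_eq_fintype_card]

/-- An operator whose leading part is `lowering` has a kernel of rank the number of subsets of
middle weight. -/
lemma finrank_ker_of_sub_lowering_mem
    (T : (Set.powersetCard (Fin (m + 1)) r → ℤ) →ₗ[ℤ] (Set.powersetCard (Fin (m + 1)) r → ℤ))
    (hT : ∀ k, ∀ x ∈ weightLT m r k, T x - lowering m r x ∈ weightLT m r (k - 2)) :
    Module.finrank ℤ (LinearMap.ker T) =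
      Nat.card {s : Set.powersetCard (Fin (m + 1)) r // weight s = r * (m + 2) / 2} := by
  set K := r * (m + 2) / 2 with hK
  have hmaps : ∀ k, ∀ x ∈ weightLT m r k, T x ∈ weightLT m r (k - 1) := fun k x hx => by
    rw [← sub_add_cancel (T x) (lowering m r x)]
    exact Submodule.add_mem _ (weightLT_mono (by omega) (hT k x hx)) (lowering_mem hx)
  have hup : ∀ x, T x = 0 → x ∈ weightLT m r (K + 1) := by
    intro x hx
    have step : ∀ j, x ∈ weightLT m r (K + 1 + j) → x ∈ weightLT m r (K + 1) := by
      intro j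
      induction j with
      | zero => exact id
      | succ j ih =>
        intro hj
        refine ih (mem_of_component_eq_zero hj ?_)
        refine eq_zero_of_lowering_eq_zero (k := K + 1 + j)
          (fun s => weight_eq_of_component_ne_zero) (by omega) ?_
        have e : K + 1 + j = (K + j) + 1 := by omega
        rw [e, lowering_component]
        apply component_eq_zero_of_mem
        have := hT _ x hj
        rw [hx, zero_sub, neg_mem_iff] at this
        exact weightLT_mono (by omega) this
    refine step (∑ s : Set.powersetCard (Fin (m + 1)) r, (weight s + 1)) fun s hs => ?_
    have := Finset.single_le_sum (f := fun s : Set.powersetCard (Fin (m + 1)) r => weight s + 1)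
      (fun _ _ => Nat.zero_le _) (Finset.mem_univ s)
    omega
  have hdown : ∀ x ∈ weightLT m r K, T (raising m r x) = 0 → x = 0 := by
    intro x hxK hx
    have step : ∀ k ≤ K, x ∈ weightLT m r k → x = 0 := by
      intro k
      induction k with
      | zero =>
        intro _ h
        rwa [weightLT_zero, Submodule.mem_bot] at h
      | succ k ih =>
        intro hk h
        refine ih (by omega) (mem_of_component_eq_zero h ?_)
        refine eq_zero_of_lowering_raising_eq_zero (k := k)
          (fun s => weight_eq_of_component_ne_zero) (by omega) ?_
        rw [raising_component, lowering_component]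
        apply component_eq_zero_of_mem
        have := hT _ _ (raising_mem h)
        rwa [hx, zero_sub, neg_mem_iff] at this
    exact step K le_rfl hxK
  let T' := T.domRestrict (weightLT m r (K + 1))
  have h1 : Module.finrank ℤ (LinearMap.ker T') = Module.finrank ℤ (LinearMap.ker T) := by
    rw [LinearMap.ker_domRestrict]
    exact (Submodule.comapSubtypeEquivOfLe fun x hx => hup x hx).finrank_eq
  have h2 : Module.finrank ℤ (LinearMap.range T') = Module.finrank ℤ (weightLT m r K) := by
    apply le_antisymm
    · apply Submodule.finrank_mono
      rintro _ ⟨x, rfl⟩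
      exact hmaps _ _ x.2
    · let g : weightLT m r K →ₗ[ℤ] LinearMap.range T' :=
        T'.rangeRestrict ∘ₗ (raising m r).restrict fun x hx => raising_mem hx
      refine LinearMap.finrank_le_finrank_of_injective (f := g) ?_
      rw [← LinearMap.ker_eq_bot, LinearMap.ker_eq_bot']
      intro x hx
      exact Subtype.ext (hdown x x.2 (congrArg Subtype.val hx))
  have h3 := (LinearMap.ker T').finrank_quotient_add_finrank
  rw [T'.quotKerEquivRange.finrank_eq, h1, h2, finrank_weightLT, finrank_weightLT] at h3
  have h4 : Nat.card {s : Set.powersetCard (Fin (m + 1)) r // weight s < K + 1} =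
      Nat.card {s : Set.powersetCard (Fin (m + 1)) r // weight s < K} +
      Nat.card {s : Set.powersetCard (Fin (m + 1)) r // weight s = K} := by
    simp only [Nat.card_eq_fintype_card, Fintype.card_subtype]
    rw [← Finset.card_union_of_disjoint]
    · congr 1
      ext s
      simp [le_iff_lt_or_eq]
    · rw [Finset.disjoint_filter]
      intro s _ h h'
      omega
  omega

lemma extPowMap_eq_map {R : Type*} [CommRing R] {M : Type*} [AddCommGroup M] [Module R M]
    (r : ℕ) (f : M →ₗ[R] M) : extPowMap r f = exteriorPower.map r f := by
  apply exteriorPower.linearMap_ext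
  ext v
  simp [extPowMap, LinearMap.restrict_apply, ExteriorAlgebra.map_apply_ιMulti, Function.comp_def]

/-- Counting subsets of `{0, …, m}` by shifted sum. -/
lemma card_weight_eq (k : ℕ) :
    Nat.card {s : Set.powersetCard (Fin (m + 1)) r // weight s = k} = numPart (m + 1) r k := by
  let f : Fin (m + 1) ↪ ℕ := ⟨fun a => (a : ℕ) + 1, fun a b h => by simpa [Fin.ext_iff] using h⟩
  have hf : ∀ a, f a = (a : ℕ) + 1 := fun _ => rfl
  rw [Nat.card_eq_fintype_card, Fintype.card_subtype, numPart]
  refine Finset.card_bij (fun s _ => s.val.map f) ?_ ?_ ?_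
  · intro s hs
    simp only [Finset.mem_filter, Finset.mem_univ, true_and] at hs
    simp only [Finset.mem_filter, Finset.mem_powerset, Finset.card_map, Finset.sum_map, id, hf]
    refine ⟨fun x hx => ?_, s.2, hs⟩
    obtain ⟨a, -, rfl⟩ := Finset.mem_map.mp hx
    rw [Finset.mem_Icc, hf]
    omega
  · intro s _ t _ h
    exact Subtype.ext (Finset.map_injective f h)
  · intro t ht
    simp only [Finset.mem_filter, Finset.mem_powerset] at ht
    obtain ⟨h1, h2, h3⟩ := ht
    have h4 : (Finset.univ.filter fun a => f a ∈ t).map f = t := by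
      ext x
      simp only [Finset.mem_map, Finset.mem_filter, Finset.mem_univ, true_and]
      refine ⟨fun ⟨a, ha, hx⟩ => hx ▸ ha, fun hx => ?_⟩
      have := Finset.mem_Icc.mp (h1 hx)
      have e : f ⟨x - 1, by omega⟩ = x := by rw [hf]; simp only; omega
      exact ⟨_, by rwa [e], e⟩
    refine ⟨⟨Finset.univ.filter fun a => f a ∈ t, ?_⟩, ?_, h4⟩
    · rw [Set.powersetCard.mem_iff, ← h2, ← Finset.card_map f, h4]
    · have h5 : t.sum id = ∑ a ∈ Finset.univ.filter fun a => f a ∈ t, f a := by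
        conv_lhs => rw [← h4, Finset.sum_map]
        rfl
      exact Finset.mem_filter.mpr ⟨Finset.mem_univ _, h5.symm.trans h3⟩

/-- The coordinates on the exterior power `Λ^r ℤ^(m + 1)` given by the standard basis. -/
noncomputable def coords (m r : ℕ) :
    (⋀[ℤ]^r (Fin (m + 1) → ℤ)) ≃ₗ[ℤ] (Set.powersetCard (Fin (m + 1)) r → ℤ) :=
  ((Pi.basisFun ℤ (Fin (m + 1))).exteriorPower r).equivFun

lemma coords_ιMulti_family (s : Set.powersetCard (Fin (m + 1)) r) :
    coords m r (exteriorPower.ιMulti_family ℤ r (Pi.basisFun ℤ (Fin (m + 1))) s) =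
      Pi.single s 1 := by
  rw [coords, ← exteriorPower.basis_apply]
  ext t
  rw [Module.Basis.equivFun_self]
  simp [Pi.single_apply, eq_comm]

lemma lower_single_of_mem (i : Fin m) {s : Set.powersetCard (Fin (m + 1)) r}
    (h1 : i.castSucc ∉ s) (h2 : i.succ ∈ s) :
    lower i (Pi.single s 1) = Pi.single (swapAt i s) 1 := by
  ext t
  rw [lower_apply]
  by_cases ht : t = swapAt i s
  · subst ht
    simp [h1, h2]
  · have : swapAt i t ≠ s := by
      rintro rfl
      exact ht (swapAt_swapAt i t).symm
    simp [this, ht]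

lemma lower_single_of_not_mem (i : Fin m) {s : Set.powersetCard (Fin (m + 1)) r}
    (h : ¬(i.castSucc ∉ s ∧ i.succ ∈ s)) : lower i (Pi.single s 1) = 0 := by
  ext t
  rw [lower_apply]
  split_ifs with ht
  · refine Pi.single_eq_of_ne ?_ 1
    rintro rfl
    exact h (by simpa using ht.symm)
  · rfl

/-- Replacing `i + 1` by `i` in a subset not containing `i` preserves the order. -/
lemma ofFinEmbEquiv_symm_swapAt (i : Fin m) {s : Set.powersetCard (Fin (m + 1)) r}
    (h1 : i.castSucc ∉ s) {p : Fin r} (hp : Set.powersetCard.ofFinEmbEquiv.symm s p = i.succ) :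
    ⇑(Set.powersetCard.ofFinEmbEquiv.symm (swapAt i s)) =
      Function.update (⇑(Set.powersetCard.ofFinEmbEquiv.symm s)) p i.castSucc := by
  have hmem (q) : Set.powersetCard.ofFinEmbEquiv.symm s q ∈ s :=
    (Set.powersetCard.mem_range_ofFinEmbEquiv_symm_iff_mem s _).mp ⟨q, rfl⟩
  have hne (q) : Set.powersetCard.ofFinEmbEquiv.symm s q ≠ i.castSucc :=
    fun h => h1 (h ▸ hmem q)
  set f := Set.powersetCard.ofFinEmbEquiv.symm s with hf
  have hne' (q) (hq : q ≠ p) : f q ≠ i.succ := fun h => hq (f.injective (h.trans hp.symm))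
  symm
  rw [Set.powersetCard.ofFinEmbEquiv_symm_apply]
  apply Finset.orderEmbOfFin_unique
  · intro q
    rw [Set.powersetCard.mem_coe_iff, mem_swapAt]
    by_cases hq : q = p
    · subst hq
      rw [Function.update_self, Equiv.swap_apply_left, ← hp]
      exact hmem q
    · rw [Function.update_of_ne hq, Equiv.swap_apply_of_ne_of_ne (hne q) (hne' q hq)]
      exact hmem q
  · intro a b hab
    have hlt : f a < f b := f.strictMono hab
    by_cases ha : a = p
    · subst ha
      rw [Function.update_self, Function.update_of_ne hab.ne']
      rw [hp] at hlt
      exact i.castSucc_lt_succ.trans hlt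
    by_cases hb : b = p
    · subst hb
      rw [Function.update_self, Function.update_of_ne ha]
      rw [hp] at hlt
      exact lt_of_le_of_ne (Fin.le_castSucc_iff.mpr hlt) (hne a)
    · rwa [Function.update_of_ne ha, Function.update_of_ne hb]

/-- In coordinates, an elementary transvection acts on the exterior power as `1 + lower i`. -/
lemma coords_map_transvection (i : Fin m) (x : ⋀[ℤ]^r (Fin (m + 1) → ℤ)) :
    coords m r (exteriorPower.map r
      (Matrix.transvection i.castSucc i.succ (1 : ℤ)).mulVecLin x) =
      coords m r x + lower i (coords m r x) := by
  suffices h : (coords m r).toLinearMap ∘ₗ exteriorPower.map r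
      (Matrix.transvection i.castSucc i.succ (1 : ℤ)).mulVecLin =
      (coords m r).toLinearMap + lower i ∘ₗ (coords m r).toLinearMap from
    LinearMap.congr_fun h x
  have hsingle (a : Fin (m + 1)) :
      (Matrix.transvection i.castSucc i.succ (1 : ℤ)).mulVecLin (Pi.basisFun ℤ _ a) =
        Pi.basisFun ℤ _ a + if a = i.succ then Pi.basisFun ℤ _ i.castSucc else 0 := by
    ext b
    simp only [Matrix.mulVecLin_apply, Pi.basisFun_apply, Matrix.mulVec_single_one,
      Matrix.transvection, Matrix.col_apply, Matrix.add_apply, Matrix.one_apply,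
      Matrix.single_apply, Pi.add_apply, Pi.single_apply]
    congr 1
    by_cases ha : a = i.succ
    · simp [ha, Pi.single_apply, eq_comm]
    · simp [ha, Ne.symm ha]
  refine ((Pi.basisFun ℤ (Fin (m + 1))).exteriorPower r).ext fun s => ?_
  rw [exteriorPower.basis_apply]
  simp only [LinearMap.comp_apply, LinearMap.add_apply, LinearEquiv.coe_coe,
    coords_ιMulti_family]
  by_cases h2 : i.succ ∈ s
  · obtain ⟨p, hp⟩ := (Set.powersetCard.mem_range_ofFinEmbEquiv_symm_iff_mem s _).mpr h2
    have e : exteriorPower.map r (Matrix.transvection i.castSucc i.succ (1 : ℤ)).mulVecLin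
        (exteriorPower.ιMulti_family ℤ r (Pi.basisFun ℤ (Fin (m + 1))) s) =
        exteriorPower.ιMulti_family ℤ r (Pi.basisFun ℤ (Fin (m + 1))) s +
        exteriorPower.ιMulti ℤ r (Pi.basisFun ℤ (Fin (m + 1)) ∘
          Function.update (⇑(Set.powersetCard.ofFinEmbEquiv.symm s)) p i.castSucc) := by
      rw [exteriorPower.map_apply_ιMulti_family, exteriorPower.ιMulti_family,
        exteriorPower.ιMulti_family, Function.comp_update]
      set v := ⇑(Pi.basisFun ℤ (Fin (m + 1))) ∘ ⇑(Set.powersetCard.ofFinEmbEquiv.symm s) with hv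
      conv_rhs => rw [← Function.update_eq_self p v]
      rw [Function.update_idem, ← AlternatingMap.map_update_add]
      congr 1
      ext1 q
      by_cases hq : q = p
      · subst hq
        rw [Function.update_self, hv, Function.comp_apply, Function.comp_apply,
          Function.comp_apply, hsingle, hp, if_pos rfl]
      · rw [Function.update_of_ne hq, hv, Function.comp_apply, Function.comp_apply,
          Function.comp_apply, hsingle, if_neg, add_zero]
        exact fun h => hq ((Set.powersetCard.ofFinEmbEquiv.symm s).injective (h.trans hp.symm))
    rw [e, map_add, coords_ιMulti_family]
    congr 1
    by_cases h1 : i.castSucc ∈ s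
    · rw [lower_single_of_not_mem i (fun h => h.1 h1)]
      obtain ⟨q, hq⟩ := (Set.powersetCard.mem_range_ofFinEmbEquiv_symm_iff_mem s _).mpr h1
      have hpq : q ≠ p := by
        rintro rfl
        exact i.castSucc_lt_succ.ne (hq.symm.trans hp)
      rw [AlternatingMap.map_eq_zero_of_eq _ _ (i := q) (j := p) _ hpq, map_zero]
      simp [hpq, hq]
    · rw [lower_single_of_mem i h1 h2, ← coords_ιMulti_family, exteriorPower.ιMulti_family,
        ofFinEmbEquiv_symm_swapAt i h1 hp]
  · rw [lower_single_of_not_mem i (fun h => h2 h.2), add_zero, ← coords_ιMulti_family,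
      exteriorPower.map_apply_ιMulti_family, exteriorPower.ιMulti_family,
      exteriorPower.ιMulti_family]
    congr 2
    ext1 q
    rw [Function.comp_apply, Function.comp_apply, Function.comp_apply, hsingle, if_neg, add_zero]
    exact fun h => h2 ((Set.powersetCard.mem_range_ofFinEmbEquiv_symm_iff_mem s _).mp ⟨q, h⟩)

/-- The unipotent matrix with `1`s on the first `j` superdiagonal places only. -/
def partialJordan (m j : ℕ) : Matrix (Fin (m + 1)) (Fin (m + 1)) ℤ :=
  Matrix.of fun a b => if (b : ℕ) = a ∨ ((b : ℕ) = a + 1 ∧ (a : ℕ) < j) then 1 else 0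

lemma partialJordan_zero : partialJordan m 0 = 1 := by
  ext a b
  simp [partialJordan, Matrix.one_apply, Fin.ext_iff, eq_comm]

lemma partialJordan_self : partialJordan m m = jordanS (m + 1) := by
  ext a b
  simp only [partialJordan, jordanS, Matrix.of_apply]
  congr 1
  have := b.isLt
  apply propext
  omega

lemma partialJordan_succ (i : Fin m) :
    partialJordan m (i + 1) =
      Matrix.transvection i.castSucc i.succ (1 : ℤ) * partialJordan m i := by
  ext a b
  rw [Matrix.transvection, add_mul, one_mul, Matrix.add_apply]
  by_cases ha : a = i.castSucc
  · subst ha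
    rw [Matrix.single_mul_apply_same]
    simp only [partialJordan, Matrix.of_apply, Fin.val_castSucc, Fin.val_succ]
    split_ifs <;> omega
  · rw [Matrix.single_mul_apply_of_ne _ _ _ _ _ ha]
    have : (a : ℕ) ≠ i := fun h => ha (Fin.ext h)
    simp only [partialJordan, Matrix.of_apply]
    split_ifs <;> omega

lemma coords_map_partialJordan (j : ℕ) (hj : j ≤ m) (k : ℕ) (x : ⋀[ℤ]^r (Fin (m + 1) → ℤ))
    (hx : coords m r x ∈ weightLT m r k) :
    coords m r (exteriorPower.map r (partialJordan m j).mulVecLin x) - coords m r x -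
      ∑ i ∈ Finset.univ.filter (fun l : Fin m => (l : ℕ) < j), lower i (coords m r x) ∈
        weightLT m r (k - 2) := by
  induction j with
  | zero => simp [partialJordan_zero, Matrix.mulVecLin_one]
  | succ j ih =>
    have ih := ih (by omega)
    let i : Fin m := ⟨j, hj⟩
    have e : (Finset.univ.filter fun l : Fin m => (l : ℕ) < j + 1) =
        insert i (Finset.univ.filter fun l : Fin m => (l : ℕ) < j) := by
      ext l
      simp [i, Fin.ext_iff, le_iff_eq_or_lt]
    rw [e, Finset.sum_insert (by simp [i]), show j = (i : ℕ) from rfl, partialJordan_succ,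
      Matrix.mulVecLin_mul, exteriorPower.map_comp, LinearMap.comp_apply,
      coords_map_transvection]
    change coords m r (exteriorPower.map r (partialJordan m i).mulVecLin x) - coords m r x -
      ∑ l ∈ Finset.univ.filter (fun l : Fin m => (l : ℕ) < i), lower l (coords m r x) ∈
        weightLT m r (k - 2) at ih
    set y := coords m r (exteriorPower.map r (partialJordan m i).mulVecLin x)
    set z := coords m r x
    have h1 : y - z ∈ weightLT m r (k - 1) := by
      rw [← sub_add_cancel (y - z)
        (∑ l ∈ Finset.univ.filter (fun l : Fin m => (l : ℕ) < i), lower l z)]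
      exact Submodule.add_mem _ (weightLT_mono (by omega) ih)
        (Submodule.sum_mem _ fun l _ => lower_mem l hx)
    have h2 := Submodule.add_mem _ ih (lower_mem i h1)
    rw [map_sub] at h2
    convert h2 using 1
    abel

end JordanExtPow

/-- For every positive integer `n` and `0 ≤ r ≤ n`, the rank of the kernel of
`∧^r S_n − id : Λ^r ℤ^n → Λ^r ℤ^n` equals `P(n, r, ⌊r(n+1)/2⌋)`. -/
theorem rank_ker_extPow_jordan (n : ℕ) (hn : 0 < n) (r : ℕ) (hr : r ≤ n) :
    Module.finrank ℤ
      (LinearMap.ker (extPowMap r (Matrix.mulVecLin (jordanS n)) - LinearMap.id)) =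
    numPart n r (r * (n + 1) / 2) := by
  obtain ⟨m, rfl⟩ := Nat.exists_eq_add_one.mpr hn
  set g := extPowMap r (Matrix.mulVecLin (jordanS (m + 1))) - LinearMap.id with hg
  let Φ := JordanExtPow.coords m r
  have hT := JordanExtPow.finrank_ker_of_sub_lowering_mem
    (Φ.toLinearMap ∘ₗ g ∘ₗ Φ.symm.toLinearMap) (fun k x hx => by
      have h := JordanExtPow.coords_map_partialJordan m le_rfl k (Φ.symm x)
        (by rwa [LinearEquiv.apply_symm_apply])
      rw [JordanExtPow.partialJordan_self, LinearEquiv.apply_symm_apply] at h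
      simpa [hg, JordanExtPow.extPowMap_eq_map, JordanExtPow.lowering, Φ] using h)
  rw [LinearEquiv.ker_comp, LinearMap.ker_comp, Submodule.comap_equiv_eq_map_symm,
    LinearEquiv.symm_symm, LinearEquiv.finrank_map_eq, JordanExtPow.card_weight_eq] at hT
  exact hT
end

section
/- (Poincaré duality) Let α be an automorphism of ℤ^n of determinant 1 (i.e. given by a matrix in SL(n,ℤ)). Then for every r with 0 ≤ r ≤ n, the endomorphisms ∧^r α − id of Λ^r ℤ^n and ∧^{n-r} α − id of Λ^{n-r} ℤ^n are equivalent over ℤ; in particular, the abelian groups coker(∧^r α − id) and coker(∧^{n-r} α − id) are isomorphic. -/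
open ExteriorAlgebra

open Module

section EquivalenceWithTranspose

variable {R F : Type*} [CommRing R] [IsDomain R] [IsPrincipalIdealRing R]
  [AddCommGroup F] [Module R F] [Module.Free R F] [Module.Finite R F]

/-- Smith normal form: an endomorphism of a finite free module over a principal ideal domain is
diagonal with respect to a suitable pair of bases. -/
theorem exists_bases_apply_eq_smul (h : F →ₗ[R] F) :
    ∃ (k : ℕ) (b b' : Basis (Fin k) R F) (d : Fin k → R), ∀ i, h (b i) = d i • b' i := by
  obtain ⟨k, bM, bN, f, a, snf⟩ := (LinearMap.range h).smithNormalForm (finBasis R F)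
  obtain ⟨l, hl⟩ := Module.projective_lifting_property h.rangeRestrict LinearMap.id
    h.surjective_rangeRestrict
  have hex : Function.Exact (LinearMap.ker h).subtype h.rangeRestrict := by
    intro x
    simp [Subtype.ext_iff]
  obtain ⟨e, he₁, he₂⟩ := hex.splitSurjectiveEquiv (Submodule.subtype_injective _) ⟨l, hl⟩
  have hrank : finrank R (LinearMap.ker h) = Fintype.card ↥(Set.range f)ᶜ := by
    have h₁ := e.finrank_eq
    rw [Module.finrank_prod, Module.finrank_eq_card_basis bN] at h₁
    rw [Fintype.card_compl_set, Set.card_range_of_injective f.injective]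
    simp at h₁ ⊢
    omega
  let bK : Basis ↥(Set.range f)ᶜ R (LinearMap.ker h) :=
    (finBasis R (LinearMap.ker h)).reindex (Fintype.equivOfCardEq (by simpa using hrank))
  let bS := ((bK.prod bN).map e.symm).reindex ((Equiv.sumComm _ _).trans
    (((Equiv.ofInjective f f.injective).sumCongr (Equiv.refl _)).trans
      (Equiv.Set.sumCompl (Set.range f))))
  have key : ∀ x, h (e.symm x) = x.2 := by
    intro x
    have := congrArg Subtype.val (LinearMap.congr_fun he₂ (e.symm x))
    simpa using this
  refine ⟨_, bS, bM, Function.extend f a 0, fun i => ?_⟩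
  by_cases hi : i ∈ Set.range f
  · obtain ⟨j, rfl⟩ := hi
    rw [f.injective.extend_apply, ← snf]
    simp [bS, key, Equiv.Set.sumCompl_symm_apply_of_mem, Equiv.ofInjective_symm_apply]
  · rw [Function.extend_apply' _ _ _ (by simpa using hi)]
    simp [bS, key, Equiv.Set.sumCompl_symm_apply_of_notMem hi]

/-- An endomorphism of a finite free module over a principal ideal domain is equivalent to its
transpose. -/
theorem exists_comp_dualMap_eq_comp (h : F →ₗ[R] F) :
    ∃ u v : Dual R F ≃ₗ[R] F, u.toLinearMap ∘ₗ h.dualMap = h ∘ₗ v.toLinearMap := by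
  obtain ⟨k, b, b', d, hd⟩ := exists_bases_apply_eq_smul h
  have hdual : ∀ i, h.dualMap (b'.dualBasis i) = d i • b.dualBasis i := by
    intro i
    refine b.ext fun j => ?_
    simp only [LinearMap.dualMap_apply, hd, map_smul, Basis.dualBasis_apply_self,
      LinearMap.smul_apply, smul_eq_mul]
    split_ifs with hij <;> simp [*]
  refine ⟨b.dualBasis.equiv b' (Equiv.refl _), b'.dualBasis.equiv b (Equiv.refl _),
    b'.dualBasis.ext fun i => ?_⟩
  simp only [LinearMap.comp_apply, hdual, map_smul, LinearEquiv.coe_coe, Basis.equiv_apply,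
    Equiv.refl_apply, hd]

end EquivalenceWithTranspose

section ExteriorPairing

variable {R M : Type*} [CommRing R] [AddCommGroup M] [Module R M]

/-- The linear form on the exterior algebra which is the determinant with respect to `b` in
degree `n` and vanishes in the other degrees. -/
noncomputable def Module.Basis.extVol {n : ℕ} (b : Basis (Fin n) R M) :
    _root_.ExteriorAlgebra R M →ₗ[R] R :=
  liftAlternating (Pi.single n b.det)

theorem Module.Basis.extVol_ιMulti {n : ℕ} (b : Basis (Fin n) R M) (v : Fin n → M) :
    b.extVol (_root_.ExteriorAlgebra.ιMulti R n v) = b.det v := by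
  simp [extVol, liftAlternating_apply_ιMulti]

theorem Module.Basis.extVol_comp_map {n : ℕ} (b : Basis (Fin n) R M) (f : M →ₗ[R] M) :
    b.extVol ∘ₗ (_root_.ExteriorAlgebra.map f).toLinearMap = LinearMap.det f • b.extVol := by
  refine lhom_ext fun i => ?_
  ext v
  simp only [LinearMap.compAlternatingMap_apply, LinearMap.comp_apply, AlgHom.toLinearMap_apply,
    map_apply_ιMulti, LinearMap.smul_apply, extVol, liftAlternating_apply_ιMulti]
  obtain rfl | hi := eq_or_ne i n
  · rw [Pi.single_eq_same, smul_eq_mul]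
    exact b.det_comp f v
  · simp [Pi.single_eq_of_ne hi]

/-- The pairing `Λ^r M × Λ^m M → R` given by the exterior product followed by the determinant
with respect to a basis. -/
noncomputable def Module.Basis.extPairing {n : ℕ} (b : Basis (Fin n) R M) (r m : ℕ) :
    (⋀[R]^r M) →ₗ[R] Dual R (⋀[R]^m M) :=
  ((LinearMap.mul R (_root_.ExteriorAlgebra R M)).compr₂ b.extVol).domRestrict₁₂ (⋀[R]^r M) (⋀[R]^m M)

theorem Module.Basis.extPairing_apply {n : ℕ} (b : Basis (Fin n) R M) (r m : ℕ)
    (x : ⋀[R]^r M) (y : ⋀[R]^m M) :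
    b.extPairing r m x y = b.extVol ((x : _root_.ExteriorAlgebra R M) * y) := rfl

theorem Module.Basis.extPairing_extPowMap {n : ℕ} (b : Basis (Fin n) R M) (r m : ℕ)
    (f : M →ₗ[R] M) (x : ⋀[R]^r M) (y : ⋀[R]^m M) :
    b.extPairing r m (extPowMap r f x) (extPowMap m f y) =
      LinearMap.det f * b.extPairing r m x y := by
  have := LinearMap.congr_fun (b.extVol_comp_map f) ((x : _root_.ExteriorAlgebra R M) * y)
  simpa [extPairing_apply, extPowMap] using this

open Set.powersetCard in
theorem Module.Basis.extPairing_basis_of_ne {n r m : ℕ} (hrm : r + m = n)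
    (b : Basis (Fin n) R M) (s : Set.powersetCard (Fin n) r) (t : Set.powersetCard (Fin n) m)
    (hst : ¬ Disjoint s.val t.val) :
    b.extPairing r m (b.exteriorPower r s) (b.exteriorPower m t) = 0 := by
  subst hrm
  simp only [extPairing_apply, exteriorPower.basis_apply, exteriorPower.ιMulti_family,
    exteriorPower.ιMulti_apply_coe, ιMulti_mul_ιMulti, extVol_ιMulti]
  obtain ⟨a, has, hat⟩ := Finset.not_disjoint_iff.mp hst
  obtain ⟨i, hi⟩ := (mem_range_ofFinEmbEquiv_symm_iff_mem s a).mpr has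
  obtain ⟨j, hj⟩ := (mem_range_ofFinEmbEquiv_symm_iff_mem t a).mpr hat
  refine b.det.map_eq_zero_of_eq _ (i := Fin.castAdd m i) (j := Fin.natAdd r j) ?_ ?_
  · simp [hi, hj]
  · intro h
    have := congrArg Fin.val h
    simp at this
    omega

open Set.powersetCard in
theorem Module.Basis.isUnit_extPairing_basis {n r m : ℕ} (hrm : r + m = n)
    (b : Basis (Fin n) R M) (s : Set.powersetCard (Fin n) r) (t : Set.powersetCard (Fin n) m)
    (hst : Disjoint s.val t.val) :
    IsUnit (b.extPairing r m (b.exteriorPower r s) (b.exteriorPower m t)) := by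
  subst hrm
  simp only [extPairing_apply, exteriorPower.basis_apply, exteriorPower.ιMulti_family,
    exteriorPower.ιMulti_apply_coe, ιMulti_mul_ιMulti, extVol_ιMulti]
  have hinj : Function.Injective (Fin.append (ofFinEmbEquiv.symm s) (ofFinEmbEquiv.symm t)) := by
    refine Fin.append_injective_iff.mpr ⟨(ofFinEmbEquiv.symm s).injective,
      (ofFinEmbEquiv.symm t).injective, fun i j hij => ?_⟩
    refine Finset.disjoint_left.mp hst
      ((mem_range_ofFinEmbEquiv_symm_iff_mem s _).mp ⟨i, rfl⟩) ?_
    rw [hij]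
    exact (mem_range_ofFinEmbEquiv_symm_iff_mem t _).mp ⟨j, rfl⟩
  let σ := Equiv.ofBijective _ hinj.bijective_of_finite
  have happ : Fin.append (b ∘ ofFinEmbEquiv.symm s) (b ∘ ofFinEmbEquiv.symm t) = b ∘ σ := by
    ext i
    refine Fin.addCases (fun j => ?_) (fun j => ?_) i <;> simp [σ]
  rw [happ, AlternatingMap.map_perm, Basis.det_self, Units.smul_def, zsmul_one]
  exact (Units.isUnit _).map (Int.castRingHom R)

/-- The exterior product pairing between complementary degrees is perfect. -/
theorem Module.Basis.extPairing_bijective {n r m : ℕ} (hrm : r + m = n)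
    (b : Basis (Fin n) R M) : Function.Bijective (b.extPairing r m) := by
  classical
  let c : Set.powersetCard (Fin n) r ≃ Set.powersetCard (Fin n) m :=
    Set.powersetCard.compl (by simpa [add_comm] using hrm)
  have hunit : ∀ s, IsUnit (b.extPairing r m (b.exteriorPower r s) (b.exteriorPower m (c s))) :=
    fun s => b.isUnit_extPairing_basis hrm s (c s) (by
      simpa [c] using disjoint_compl_right)
  let B := ((b.exteriorPower m).dualBasis.reindex c.symm).unitsSMul fun s => (hunit s).unit
  have hB : b.extPairing r m = ((b.exteriorPower r).equiv B (Equiv.refl _)).toLinearMap := by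
    refine (b.exteriorPower r).ext fun s => (b.exteriorPower m).ext fun t => ?_
    rw [LinearEquiv.coe_coe, Basis.equiv_apply, Equiv.refl_apply, Basis.unitsSMul_apply,
      Units.smul_def, LinearMap.smul_apply, Basis.reindex_apply, Equiv.symm_symm,
      Basis.dualBasis_apply_self, IsUnit.unit_spec]
    split_ifs with hts
    · simp [hts]
    · rw [smul_zero]
      refine b.extPairing_basis_of_ne hrm s t fun hd => hts ?_
      rw [Set.powersetCard.eq_iff_subset]
      intro x hx
      simpa [c] using Finset.disjoint_right.mp hd hx
  rw [hB]
  exact LinearEquiv.bijective _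

end ExteriorPairing

theorem exists_equiv_extPowMap_sub_id {R M : Type*} [CommRing R] [IsDomain R]
    [IsPrincipalIdealRing R] [AddCommGroup M] [Module R M] {n r m : ℕ} (hrm : r + m = n)
    (b : Basis (Fin n) R M) (f : M →ₗ[R] M) (hf : LinearMap.det f = 1) :
    ∃ u v : (⋀[R]^r M) ≃ₗ[R] (⋀[R]^m M),
      u.toLinearMap ∘ₗ (extPowMap r f - LinearMap.id) ∘ₗ v.symm.toLinearMap =
        extPowMap m f - LinearMap.id := by
  have : Module.Free R M := .of_basis b
  have : Module.Finite R M := .of_basis b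
  let p : (⋀[R]^r M) ≃ₗ[R] Dual R (⋀[R]^m M) :=
    LinearEquiv.ofBijective _ (b.extPairing_bijective hrm)
  have hp : ∀ x, (extPowMap m f).dualMap (p (extPowMap r f x)) = p x := fun x =>
    LinearMap.ext fun y => by simpa [hf, p] using b.extPairing_extPowMap r m f x y
  have hG : (extPowMap m f).dualMap * p.conj (extPowMap r f) = 1 := by
    ext1 x
    simp [LinearEquiv.conj_apply, hp]
  let G : Dual R (⋀[R]^m M) ≃ₗ[R] Dual R (⋀[R]^m M) :=
    LinearEquiv.ofLinearMap _ _ hG (mul_eq_one_comm.mp hG)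
  obtain ⟨u, v, huv⟩ := exists_comp_dualMap_eq_comp (extPowMap m f - LinearMap.id)
  refine ⟨((p.trans G).trans u).trans (LinearEquiv.neg R), p.trans v, LinearMap.ext fun y => ?_⟩
  obtain ⟨x, rfl⟩ := (p.trans v).surjective y
  have h₁ := LinearMap.congr_fun huv (p x)
  have h₂ : (extPowMap m f - LinearMap.id).dualMap (p x) =
      -(G (p (extPowMap r f x - x))) := by
    have : G (p (extPowMap r f x)) = p x := hp x
    rw [map_sub, map_sub, this, neg_sub]
    ext y
    simp [G]
  simp only [LinearMap.comp_apply, LinearEquiv.coe_coe] at h₁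
  rw [h₂] at h₁
  simpa using h₁

/-- (Poincaré duality) Let `α` be an automorphism of `ℤ^n` given by a matrix of determinant `1`.
Then for `0 ≤ r ≤ n` the endomorphisms `∧^r α − id` of `Λ^r ℤ^n` and `∧^{n-r} α − id` of
`Λ^{n-r} ℤ^n` are equivalent over `ℤ` (there are isomorphisms `u, v` with `u ∘ φ ∘ v⁻¹ = ψ`);
in particular their cokernels are isomorphic. -/
theorem poincare_duality (n : ℕ) (A : Matrix (Fin n) (Fin n) ℤ) (hA : A.det = 1)
    (r : ℕ) (hr : r ≤ n) :
    (∃ (u v : (⋀[ℤ]^r (Fin n → ℤ)) ≃ₗ[ℤ] (⋀[ℤ]^(n - r) (Fin n → ℤ))),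
        (u : (⋀[ℤ]^r (Fin n → ℤ)) →ₗ[ℤ] (⋀[ℤ]^(n - r) (Fin n → ℤ))) ∘ₗ
            (extPowMap r (Matrix.mulVecLin A) - LinearMap.id) ∘ₗ
            (v.symm : (⋀[ℤ]^(n - r) (Fin n → ℤ)) →ₗ[ℤ] (⋀[ℤ]^r (Fin n → ℤ))) =
          extPowMap (n - r) (Matrix.mulVecLin A) - LinearMap.id) ∧
    Nonempty
      (((⋀[ℤ]^r (Fin n → ℤ)) ⧸
          LinearMap.range (extPowMap r (Matrix.mulVecLin A) - LinearMap.id)) ≃ₗ[ℤ]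
        ((⋀[ℤ]^(n - r) (Fin n → ℤ)) ⧸
          LinearMap.range (extPowMap (n - r) (Matrix.mulVecLin A) - LinearMap.id))) := by
  obtain ⟨u, v, huv⟩ := exists_equiv_extPowMap_sub_id (Nat.add_sub_of_le hr)
    (Pi.basisFun ℤ (Fin n)) (Matrix.mulVecLin A)
    (by rw [← Matrix.toLin'_apply', LinearMap.det_toLin', hA])
  refine ⟨⟨u, v, huv⟩, ⟨Submodule.Quotient.equiv _ _ u ?_⟩⟩
  rw [← huv, LinearMap.range_comp, LinearMap.range_comp, LinearEquiv.range, Submodule.map_top]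
end

section
/- Let α be an automorphism of ℤ^n of determinant 1. Then for every r with 0 ≤ r ≤ n, the rank of the kernel of ∧^r α − id (as an endomorphism of Λ^r ℤ^n) equals the rank of the kernel of ∧^{n-r} α − id (as an endomorphism of Λ^{n-r} ℤ^n). -/
open ExteriorAlgebra

/-- Over a principal ideal domain, the dual of a finitely generated module has rank at most that
of the module. -/
theorem finrank_dual_le_of_isPrincipalIdealRing {R N : Type*} [CommRing R] [IsDomain R]
    [IsPrincipalIdealRing R] [AddCommGroup N] [Module R N] [Module.Finite R N] :
    Module.finrank R (Module.Dual R N) ≤ Module.finrank R N := by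
  set T := Submodule.torsion R N
  have hT : T.dualAnnihilator = ⊤ := by
    refine eq_top_iff.2 fun φ _ => ?_
    rw [Submodule.mem_dualAnnihilator]
    rintro x ⟨a, ha⟩
    have h : (a : R) * φ x = 0 := by
      rw [← smul_eq_mul, ← map_smul]
      exact (congrArg φ ha).trans (map_zero φ)
    exact (mul_eq_zero.1 h).resolve_left (nonZeroDivisors.coe_ne_zero a)
  have e : Module.Dual R (N ⧸ T) ≃ₗ[R] Module.Dual R N :=
    T.dualQuotEquivDualAnnihilator.trans (LinearEquiv.ofTop _ hT)
  rw [← e.finrank_eq, Module.finrank_linearMap_self R R (N ⧸ T)]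
  exact (Submodule.finrank_quotient_add_finrank T).symm ▸ Nat.le_add_right _ _

/-- The kernel of the transpose of an endomorphism has rank at most that of the kernel. -/
theorem finrank_ker_dualMap_le {R Q : Type*} [CommRing R] [IsDomain R]
    [IsPrincipalIdealRing R] [AddCommGroup Q] [Module R Q] [Module.Finite R Q] (h : Q →ₗ[R] Q) :
    Module.finrank R (LinearMap.ker h.dualMap) ≤ Module.finrank R (LinearMap.ker h) := by
  rw [LinearMap.ker_dualMap_eq_dualAnnihilator_range,
    ← (LinearMap.range h).dualQuotEquivDualAnnihilator.finrank_eq]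
  refine finrank_dual_le_of_isPrincipalIdealRing.trans ?_
  have h₁ := Submodule.finrank_quotient_add_finrank (LinearMap.range h)
  have h₂ := Submodule.finrank_quotient_add_finrank (LinearMap.ker h)
  rw [h.quotKerEquivRange.finrank_eq] at h₂
  omega

section TopForm

variable {R M : Type*} [CommRing R] [AddCommGroup M] [Module R M] {n : ℕ}

/-- The functional on the exterior algebra that is the determinant with respect to a basis in the
top degree, and zero in all other degrees. -/
noncomputable def topForm (b : Module.Basis (Fin n) R M) : ExteriorAlgebra R M →ₗ[R] R :=
  liftAlternating (Pi.single n b.det)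

theorem topForm_ιMulti (b : Module.Basis (Fin n) R M) (v : Fin n → M) :
    topForm b (ιMulti R n v) = b.det v := by
  simp [topForm, liftAlternating_apply_ιMulti]

theorem topForm_map (b : Module.Basis (Fin n) R M) (f : M →ₗ[R] M) (x : ExteriorAlgebra R M) :
    topForm b (ExteriorAlgebra.map f x) = LinearMap.det f * topForm b x := by
  suffices h : topForm b ∘ₗ (ExteriorAlgebra.map f).toLinearMap =
      LinearMap.det f • topForm b from LinearMap.congr_fun h x
  ext i v
  obtain rfl | hi := eq_or_ne i n
  · simp [map_apply_ιMulti, topForm_ιMulti, Module.Basis.det_comp]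
  · simp [map_apply_ιMulti, topForm, liftAlternating_apply_ιMulti, Pi.single_eq_of_ne hi]

theorem topForm_basis_ne_zero [Nontrivial R] (b : Module.Basis (Fin n) R M)
    (u : Set.powersetCard (Fin n) n) : topForm b (b.ExteriorAlgebra (u : Finset (Fin n))) ≠ 0 := by
  rw [ExteriorAlgebra.basis_apply_powersetCard, ExteriorAlgebra.ιMulti_family, topForm_ιMulti]
  have hσ := Finite.injective_iff_bijective.1 (Set.powersetCard.ofFinEmbEquiv.symm u).injective
  have h := b.det.map_perm b (Equiv.ofBijective _ hσ)
  rw [b.det_self] at h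
  change b.det (b ∘ (Equiv.ofBijective _ hσ)) ≠ 0
  rw [show b.det (b ∘ (Equiv.ofBijective _ hσ)) = _ from h]
  rcases Int.units_eq_one_or (Equiv.Perm.sign (Equiv.ofBijective _ hσ)) with h' | h' <;>
    simp [h']

/-- The pairing of the `r`-th and the `s`-th exterior power given by the wedge product followed by
the top form. -/
noncomputable def wedgePairing (b : Module.Basis (Fin n) R M) (r s : ℕ) :
    ⋀[R]^r M →ₗ[R] Module.Dual R (⋀[R]^s M) :=
  ((LinearMap.mul R (ExteriorAlgebra R M)).compr₂ (topForm b)).domRestrict₁₂ _ _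

theorem wedgePairing_apply (b : Module.Basis (Fin n) R M) {r s : ℕ} (x : ⋀[R]^r M)
    (y : ⋀[R]^s M) : wedgePairing b r s x y =
      topForm b ((x : ExteriorAlgebra R M) * (y : ExteriorAlgebra R M)) := rfl

theorem wedgePairing_extPowMap (b : Module.Basis (Fin n) R M) (f : M →ₗ[R] M) {r s : ℕ}
    (x : ⋀[R]^r M) (y : ⋀[R]^s M) :
    wedgePairing b r s (extPowMap r f x) (extPowMap s f y) =
      LinearMap.det f * wedgePairing b r s x y := by
  rw [wedgePairing_apply, wedgePairing_apply, ← topForm_map, map_mul (ExteriorAlgebra.map f)]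
  rfl

theorem wedgePairing_basis_compl_of_ne (b : Module.Basis (Fin n) R M) {r s : ℕ}
    (hsr : s + r = Fintype.card (Fin n)) {t u : Set.powersetCard (Fin n) r} (htu : t ≠ u) :
    wedgePairing b r s (b.exteriorPower r t)
      (b.exteriorPower s (Set.powersetCard.compl hsr u)) = 0 := by
  have hdisj : ¬Disjoint (t : Finset (Fin n))
      (Set.powersetCard.compl hsr u : Finset (Fin n)) := by
    rw [Set.powersetCard.coe_compl, disjoint_compl_right_iff]
    intro hle
    refine htu (Subtype.ext (Finset.eq_of_subset_of_card_le hle ?_))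
    rw [Set.powersetCard.card_eq, Set.powersetCard.card_eq]
  rw [wedgePairing_apply, ← ExteriorAlgebra.basis_eq_coe_basis,
    ← ExteriorAlgebra.basis_eq_coe_basis, ExteriorAlgebra.basis_mul_of_not_disjoint _ _ _ hdisj,
    map_zero]

theorem wedgePairing_basis_compl_self_ne_zero [Nontrivial R] (b : Module.Basis (Fin n) R M)
    {r s : ℕ} (hsr : s + r = Fintype.card (Fin n)) (u : Set.powersetCard (Fin n) r) :
    wedgePairing b r s (b.exteriorPower r u)
      (b.exteriorPower s (Set.powersetCard.compl hsr u)) ≠ 0 := by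
  have hdisj : Disjoint (u : Finset (Fin n))
      (Set.powersetCard.compl hsr u : Finset (Fin n)) := by
    rw [Set.powersetCard.coe_compl]
    exact disjoint_compl_right
  obtain rfl : r + s = n := by simpa [add_comm] using hsr
  rw [wedgePairing_apply, ← ExteriorAlgebra.basis_eq_coe_basis,
    ← ExteriorAlgebra.basis_eq_coe_basis, ExteriorAlgebra.basis_mul_of_disjoint _ _ _ hdisj]
  have h := topForm_basis_ne_zero b (Set.powersetCard.disjUnion hdisj)
  rcases Int.units_eq_one_or (Set.powersetCard.permOfDisjoint hdisj).sign with h' | h' <;>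
    simpa [h'] using h

theorem wedgePairing_injective [IsDomain R] (b : Module.Basis (Fin n) R M) {r s : ℕ}
    (hrs : r + s = n) : Function.Injective (wedgePairing b r s) := by
  have hsr : s + r = Fintype.card (Fin n) := by rw [Fintype.card_fin, add_comm, hrs]
  refine (injective_iff_map_eq_zero _).2 fun x hx => (b.exteriorPower r).ext_elem fun u => ?_
  have h := LinearMap.congr_fun hx (b.exteriorPower s (Set.powersetCard.compl hsr u))
  rw [← (b.exteriorPower r).sum_repr x, map_sum, LinearMap.sum_apply,
    Finset.sum_eq_single_of_mem u (Finset.mem_univ u)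
      fun t _ htu => by
        rw [map_smul, LinearMap.smul_apply, wedgePairing_basis_compl_of_ne b hsr htu, smul_zero],
    map_smul, LinearMap.smul_apply, smul_eq_mul, LinearMap.zero_apply] at h
  rw [map_zero, Finsupp.zero_apply]
  exact (mul_eq_zero.1 h).resolve_right (wedgePairing_basis_compl_self_ne_zero b hsr u)

end TopForm

/-- If `f` has determinant `1`, the rank of the fixed part of `∧^r f` is at most that of the
fixed part of `∧^s f`, for complementary degrees `r` and `s`. -/
theorem finrank_ker_extPowMap_sub_id_le {R M : Type*} [CommRing R] [IsDomain R]
    [IsPrincipalIdealRing R] [AddCommGroup M] [Module R M] {n : ℕ}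
    (b : Module.Basis (Fin n) R M) (f : M →ₗ[R] M) (hf : LinearMap.det f = 1) {r s : ℕ}
    (hrs : r + s = n) :
    Module.finrank R (LinearMap.ker (extPowMap r f - LinearMap.id)) ≤
      Module.finrank R (LinearMap.ker (extPowMap s f - LinearMap.id)) := by
  have := Module.Finite.of_basis b
  have := Module.Free.of_basis b
  refine le_trans ?_ (finrank_ker_dualMap_le _)
  have hmem (x : LinearMap.ker (extPowMap r f - LinearMap.id)) :
      wedgePairing b r s x ∈ LinearMap.ker (extPowMap s f - LinearMap.id).dualMap := by
    have hx : extPowMap r f x = x := sub_eq_zero.1 (LinearMap.mem_ker.1 x.2)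
    refine LinearMap.ext fun y => ?_
    have h := wedgePairing_extPowMap b f (x : ⋀[R]^r M) y
    rw [hx, hf, one_mul] at h
    simp [h]
  exact LinearMap.finrank_le_finrank_of_injective
    (f := LinearMap.codRestrict _ ((wedgePairing b r s).domRestrict _) hmem)
    fun x y hxy => Subtype.ext (wedgePairing_injective b hrs (congrArg Subtype.val hxy))

/-- Let `α` be an automorphism of `ℤ^n` given by a matrix of determinant `1`. Then for
`0 ≤ r ≤ n`, the rank of the kernel of `∧^r α − id` equals the rank of the kernel of
`∧^{n-r} α − id`. -/
theorem rank_ker_extPow_duality (n : ℕ) (A : Matrix (Fin n) (Fin n) ℤ) (hA : A.det = 1)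
    (r : ℕ) (hr : r ≤ n) :
    Module.finrank ℤ
        (LinearMap.ker (extPowMap r (Matrix.mulVecLin A) - LinearMap.id)) =
      Module.finrank ℤ
        (LinearMap.ker (extPowMap (n - r) (Matrix.mulVecLin A) - LinearMap.id)) := by
  have hdet : LinearMap.det (Matrix.mulVecLin A) = 1 := by
    rw [← Matrix.toLin'_apply', LinearMap.det_toLin', hA]
  exact le_antisymm
    (finrank_ker_extPowMap_sub_id_le (Pi.basisFun ℤ (Fin n)) _ hdet (by omega))
    (finrank_ker_extPowMap_sub_id_le (Pi.basisFun ℤ (Fin n)) _ hdet (by omega))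
end

section
/- The cokernel of the endomorphism ∧^3 S_6 − id of the 20-dimensional free abelian group Λ^3 ℤ^6 is isomorphic to ℤ^3 ⊕ ℤ/2ℤ. (This implies, contrary to a claim of R. Ji, that the torsion subgroup arising from the Anzai transformation on 𝕋^6 is nontrivial.) -/
open ExteriorAlgebra

open exteriorPower in
/-- Alternating maps in three variables on a module with a basis indexed by `Fin n` agree as soon
as they agree on strictly increasing triples of basis vectors. -/
theorem alternatingMap_three_ext {n : ℕ} {R M N : Type*} [CommRing R] [AddCommGroup M]
    [Module R M] [AddCommGroup N] [Module R N] (b : Module.Basis (Fin n) R M)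
    {g g' : M [⋀^Fin 3]→ₗ[R] N}
    (h : ∀ i j k, i < j → j < k → g ![b i, b j, b k] = g' ![b i, b j, b k]) : g = g' := by
  apply alternatingMapLinearEquiv.injective
  apply LinearMap.ext_on (exteriorPower.ιMulti_family_span_of_span R b.span_eq)
  rintro _ ⟨s, rfl⟩
  rw [exteriorPower.ιMulti_family, alternatingMapLinearEquiv_apply_ιMulti,
    alternatingMapLinearEquiv_apply_ιMulti]
  generalize Set.powersetCard.ofFinEmbEquiv.symm s = o
  have ho : b ∘ o = ![b (o 0), b (o 1), b (o 2)] := by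
    ext1 i; fin_cases i <;> rfl
  rw [ho]
  exact h _ _ _ (o.strictMono (by decide)) (o.strictMono (by decide))

/-- The standard basis vectors of `ℤ^6` indexed by `1, …, 6`; all other indices give `0`. -/
def stdVec (i : ℕ) : Fin 6 → ℤ := fun k => if (k : ℕ) + 1 = i then 1 else 0

theorem basisFun_eq_stdVec (i : Fin 6) : Pi.basisFun ℤ (Fin 6) i = stdVec (i + 1) := by
  ext k
  simp [stdVec, Pi.single_apply, Fin.ext_iff]

theorem stdVec_zero : stdVec 0 = 0 := by
  ext k
  simp [stdVec]

theorem jordanS_mulVec_stdVec_succ (i : Fin 6) :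
    (jordanS 6).mulVec (stdVec (i + 1)) = stdVec (i + 1) + stdVec i := by
  revert i
  decide

/-- The `3 × 3` minor with columns `s`, as an alternating map in the three rows. -/
def minorMap (s : Fin 3 → Fin 6) : (Fin 6 → ℤ) [⋀^Fin 3]→ₗ[ℤ] ℤ :=
  Matrix.detRowAlternating.compLinearMap (LinearMap.funLeft ℤ ℤ s)

theorem minorMap_apply (s : Fin 3 → Fin 6) (v : Fin 3 → Fin 6 → ℤ) :
    minorMap s v =
      v 0 (s 0) * v 1 (s 1) * v 2 (s 2) - v 0 (s 0) * v 1 (s 2) * v 2 (s 1)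
      - v 0 (s 1) * v 1 (s 0) * v 2 (s 2) + v 0 (s 1) * v 1 (s 2) * v 2 (s 0)
      + v 0 (s 2) * v 1 (s 0) * v 2 (s 1) - v 0 (s 2) * v 1 (s 1) * v 2 (s 0) :=
  Matrix.det_fin_three _

/-- Three alternating forms invariant under `S_6`. -/
def freeForm : Fin 3 → (Fin 6 → ℤ) [⋀^Fin 3]→ₗ[ℤ] ℤ :=
  ![minorMap ![1, 3, 5] + minorMap ![2, 3, 5] - minorMap ![0, 4, 5] - minorMap ![1, 4, 5]
      - minorMap ![2, 3, 4],
    minorMap ![1, 3, 5] + minorMap ![2, 4, 5] - minorMap ![0, 4, 5] - minorMap ![2, 3, 4],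
    minorMap ![3, 4, 5]]

/-- An alternating form invariant under `S_6` modulo `2`. -/
def torsionForm : (Fin 6 → ℤ) [⋀^Fin 3]→ₗ[ℤ] ℤ :=
  minorMap ![0, 2, 5] + minorMap ![0, 3, 4] + minorMap ![1, 2, 4] + minorMap ![0, 3, 5]
    + minorMap ![1, 2, 5] + minorMap ![1, 3, 4] + minorMap ![1, 3, 5]

theorem jordanS_six_mulVec (v : Fin 6 → ℤ) :
    (jordanS 6).mulVec v =
      ![v 0 + v 1, v 1 + v 2, v 2 + v 3, v 3 + v 4, v 4 + v 5, v 5] := by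
  ext i
  fin_cases i <;> simp [jordanS, Matrix.mulVec, dotProduct, Fin.sum_univ_six]

theorem freeForm_jordanS (l : Fin 3) (v : Fin 3 → Fin 6 → ℤ) :
    freeForm l (fun t => (jordanS 6).mulVec (v t)) = freeForm l v := by
  fin_cases l <;> simp [freeForm, minorMap_apply, jordanS_six_mulVec] <;> ring

theorem torsionForm_jordanS (v : Fin 3 → Fin 6 → ℤ) :
    (torsionForm (fun t => (jordanS 6).mulVec (v t)) : ZMod 2) = torsionForm v := by
  have h : torsionForm (fun t => (jordanS 6).mulVec (v t)) = torsionForm v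
      + 2 * (minorMap ![0, 3, 5] v + minorMap ![1, 2, 5] v + minorMap ![1, 3, 4] v
        + minorMap ![0, 4, 5] v + 3 * minorMap ![1, 3, 5] v + minorMap ![2, 3, 4] v
        + 2 * minorMap ![1, 4, 5] v + 2 * minorMap ![2, 3, 5] v + minorMap ![2, 4, 5] v) := by
    simp [torsionForm, minorMap_apply, jordanS_six_mulVec]
    ring
  rw [h, Int.cast_add, Int.cast_mul, Int.cast_ofNat, show (2 : ZMod 2) = 0 from rfl, zero_mul,
    add_zero]

section Invariant

variable {Q : Type*} [AddCommGroup Q] {g : (Fin 6 → ℤ) [⋀^Fin 3]→ₗ[ℤ] Q}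

/-- The value of an alternating map on three of the vectors `stdVec`. -/
def onStd (g : (Fin 6 → ℤ) [⋀^Fin 3]→ₗ[ℤ] Q) (i j k : ℕ) : Q :=
  g ![stdVec i, stdVec j, stdVec k]

theorem onStd_zero (j k : ℕ) : onStd g 0 j k = 0 :=
  g.map_coord_zero 0 (by simp [stdVec_zero])

theorem onStd_self_left (i k : ℕ) : onStd g i i k = 0 :=
  g.map_eq_zero_of_eq _ (i := 0) (j := 1) (by simp) (by decide)

theorem onStd_self_right (i j : ℕ) : onStd g i j j = 0 :=
  g.map_eq_zero_of_eq _ (i := 1) (j := 2) (by simp) (by decide)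

theorem onStd_relation (hg : ∀ v, g (fun t => (jordanS 6).mulVec (v t)) = g v) (i j k : Fin 6) :
    onStd g i (j + 1) (k + 1) + onStd g (i + 1) j (k + 1) + onStd g (i + 1) (j + 1) k
      + onStd g i j (k + 1) + onStd g i (j + 1) k + onStd g (i + 1) j k + onStd g i j k = 0 := by
  have add0 (a a' b c : Fin 6 → ℤ) : g ![a + a', b, c] = g ![a, b, c] + g ![a', b, c] := by
    convert g.map_update_add ![0, b, c] 0 a a' using 3 <;> (ext1 t; fin_cases t <;> rfl)
  have add1 (a b b' c : Fin 6 → ℤ) : g ![a, b + b', c] = g ![a, b, c] + g ![a, b', c] := by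
    convert g.map_update_add ![a, 0, c] 1 b b' using 3 <;> (ext1 t; fin_cases t <;> rfl)
  have add2 (a b c c' : Fin 6 → ℤ) : g ![a, b, c + c'] = g ![a, b, c] + g ![a, b, c'] := by
    convert g.map_update_add ![a, b, 0] 2 c c' using 3 <;> (ext1 t; fin_cases t <;> rfl)
  have h := hg ![stdVec (i + 1), stdVec (j + 1), stdVec (k + 1)]
  have hv : (fun t => (jordanS 6).mulVec
      ((![stdVec (i + 1), stdVec (j + 1), stdVec (k + 1)] : Fin 3 → Fin 6 → ℤ) t)) =
      ![stdVec (i + 1) + stdVec i, stdVec (j + 1) + stdVec j, stdVec (k + 1) + stdVec k] := by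
    ext1 t
    fin_cases t <;> exact jordanS_mulVec_stdVec_succ _
  rw [hv] at h
  simp only [add0, add1, add2] at h
  simp only [onStd]
  rw [← sub_eq_zero] at h
  rw [← h]
  abel

theorem onStd_values (hg : ∀ v, g (fun t => (jordanS 6).mulVec (v t)) = g v) :
    (2 : ℤ) • onStd g 1 3 6 = 0 ∧
    onStd g 1 2 3 = 0 ∧
    onStd g 1 2 4 = 0 ∧
    onStd g 1 2 5 = 0 ∧
    onStd g 1 3 4 = 0 ∧
    onStd g 1 2 6 = 0 ∧
    onStd g 1 3 5 = 0 ∧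
    onStd g 2 3 4 = 0 ∧
    onStd g 1 4 5 = onStd g 1 3 6 ∧
    onStd g 2 3 5 = onStd g 1 3 6 ∧
    onStd g 1 4 6 = onStd g 1 3 6 ∧
    onStd g 2 3 6 = onStd g 1 3 6 ∧
    onStd g 2 4 5 = onStd g 1 3 6 ∧
    onStd g 1 5 6 = -onStd g 3 4 6 - onStd g 3 5 6 ∧
    onStd g 2 4 6 = onStd g 1 3 6 + onStd g 3 4 6 + onStd g 3 5 6 ∧
    onStd g 3 4 5 = -onStd g 3 4 6 - onStd g 3 5 6 ∧
    onStd g 2 5 6 = -onStd g 3 4 6 := by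
  have r124 := onStd_relation hg 0 1 3
  have r125 := onStd_relation hg 0 1 4
  have r126 := onStd_relation hg 0 1 5
  have r135 := onStd_relation hg 0 2 4
  have r136 := onStd_relation hg 0 2 5
  have r145 := onStd_relation hg 0 3 4
  have r235 := onStd_relation hg 1 2 4
  have r146 := onStd_relation hg 0 3 5
  have r236 := onStd_relation hg 1 2 5
  have r245 := onStd_relation hg 1 3 4
  have r156 := onStd_relation hg 0 4 5
  have r246 := onStd_relation hg 1 3 5
  have r345 := onStd_relation hg 2 3 4
  have r256 := onStd_relation hg 1 4 5
  have r346 := onStd_relation hg 2 3 5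
  have r356 := onStd_relation hg 2 4 5
  have r456 := onStd_relation hg 3 4 5
  simp [onStd_zero, onStd_self_left, onStd_self_right]
    at r124 r125 r126 r135 r136 r145 r235 r146 r236 r245 r156 r246 r345 r256 r346 r356 r456
  have v123 : onStd g 1 2 3 = 0 := by linear_combination (norm := module) r124
  have v124 : onStd g 1 2 4 = 0 := by linear_combination (norm := module) r125
  have v125 : onStd g 1 2 5 = 0 := by linear_combination (norm := module) r126
  have v134 : onStd g 1 3 4 = 0 := by linear_combination (norm := module) r135 - v125 - v124
  have v135 : onStd g 1 3 5 = 0 := by linear_combination (norm := module) r145 - v134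
  have v234 : onStd g 2 3 4 = 0 := by
    linear_combination (norm := module) r235 - v135 - v125 - v134 - v124
  have v126 : onStd g 1 2 6 = 0 := by linear_combination (norm := module) r136 - v135 - v125
  have hT : (2 : ℤ) • onStd g 1 3 6 = 0 := by
    linear_combination (norm := module) r146 + r236 - r245 - v135 - v126 - v125 + v234 + v134
  have v145 : onStd g 1 4 5 = onStd g 1 3 6 := by
    linear_combination (norm := module) r146 - v135 - hT
  have v235 : onStd g 2 3 5 = onStd g 1 3 6 := by
    linear_combination (norm := module) r236 - v126 - v135 - v125 - hT
  have v146 : onStd g 1 4 6 = onStd g 1 3 6 := by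
    linear_combination (norm := module) r156 - v145 - hT
  have v245 : onStd g 2 4 5 = onStd g 1 3 6 := by
    linear_combination (norm := module) r345 - v235 - v234 - hT
  have v236 : onStd g 2 3 6 = onStd g 1 3 6 := by
    linear_combination (norm := module) r246 - v146 - v245 - v145 - v235 - v135 - (3 : ℤ) • hT
  have v345 : onStd g 3 4 5 = -onStd g 3 4 6 - onStd g 3 5 6 := by
    linear_combination (norm := module) r456
  have v246 : onStd g 2 4 6 = onStd g 1 3 6 + onStd g 3 4 6 + onStd g 3 5 6 := by
    linear_combination (norm := module) r346 - v345 - v236 - v245 - v235 - (2 : ℤ) • hT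
  have v156 : onStd g 1 5 6 = -onStd g 3 4 6 - onStd g 3 5 6 := by
    linear_combination (norm := module) r256 - v246 - v146 - v245 - v145 - (2 : ℤ) • hT
  have v256 : onStd g 2 5 6 = -onStd g 3 4 6 := by
    linear_combination (norm := module) r356 - v246 - v345 - v245 - hT
  exact ⟨hT, v123, v124, v125, v134, v126, v135, v234, v145, v235, v146, v236, v245,
    v156, v246, v345, v256⟩

theorem eq_forms_of_invariant (hg : ∀ v, g (fun t => (jordanS 6).mulVec (v t)) = g v)
    (v : Fin 3 → Fin 6 → ℤ) :
    g v = freeForm 0 v • onStd g 3 4 6 + freeForm 1 v • onStd g 3 5 6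
      + freeForm 2 v • onStd g 4 5 6 + torsionForm v • onStd g 1 3 6 := by
  let e (x : Q) : ℤ →ₗ[ℤ] Q := LinearMap.toSpanSingleton ℤ Q x
  suffices h : g = (e (onStd g 3 4 6)).compAlternatingMap (freeForm 0)
      + (e (onStd g 3 5 6)).compAlternatingMap (freeForm 1)
      + (e (onStd g 4 5 6)).compAlternatingMap (freeForm 2)
      + (e (onStd g 1 3 6)).compAlternatingMap torsionForm by
    simpa [e] using DFunLike.congr_fun h v
  refine alternatingMap_three_ext (Pi.basisFun ℤ (Fin 6)) fun i j k hij hjk => ?_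
  have hval := onStd_values hg
  simp only [basisFun_eq_stdVec, AlternatingMap.add_apply, LinearMap.compAlternatingMap_apply,
    e, LinearMap.toSpanSingleton_apply]
  change onStd g _ _ _ = _
  fin_cases i <;> fin_cases j <;> try exact absurd hij (by decide)
  all_goals fin_cases k <;> try exact absurd hjk (by decide)
  all_goals simp [freeForm, torsionForm, minorMap_apply, stdVec, hval] <;> abel

end Invariant

open exteriorPower in
/-- The forms `freeForm` and the reduction of `torsionForm`, as a map on the exterior power. -/
noncomputable def formsMap : (⋀[ℤ]^3 (Fin 6 → ℤ)) →ₗ[ℤ] (Fin 3 → ℤ) × ZMod 2 :=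
  (LinearMap.pi fun l => alternatingMapLinearEquiv (freeForm l)).prod
    ((Int.castAddHom (ZMod 2)).toIntLinearMap ∘ₗ alternatingMapLinearEquiv torsionForm)

theorem formsMap_ιMulti (v : Fin 3 → Fin 6 → ℤ) :
    formsMap (exteriorPower.ιMulti ℤ 3 v) = (fun l => freeForm l v, (torsionForm v : ZMod 2)) := by
  simp [formsMap, LinearMap.pi_apply, funext_iff]

theorem extPowMap_ιMulti {R M : Type*} [CommRing R] [AddCommGroup M] [Module R M] (r : ℕ)
    (f : M →ₗ[R] M) (v : Fin r → M) :
    extPowMap r f (exteriorPower.ιMulti R r v) = exteriorPower.ιMulti R r (fun t => f (v t)) := by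
  apply Subtype.ext
  exact ExteriorAlgebra.map_apply_ιMulti f v

theorem range_le_ker_formsMap :
    LinearMap.range (extPowMap 3 (Matrix.mulVecLin (jordanS 6)) - LinearMap.id) ≤
      LinearMap.ker formsMap := by
  rw [LinearMap.range_le_ker_iff]
  ext1
  ext1 v
  simp [extPowMap_ιMulti, formsMap_ιMulti, freeForm_jordanS, torsionForm_jordanS,
    -exteriorPower.ιMulti_apply_coe]

/-- The cokernel of `∧^3 S_6 − id : Λ^3 ℤ^6 → Λ^3 ℤ^6` is isomorphic to `ℤ^3 ⊕ ℤ/2ℤ`. -/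
theorem coker_extPow_three_jordan_six :
    Nonempty
      (((⋀[ℤ]^3 (Fin 6 → ℤ)) ⧸
          LinearMap.range (extPowMap 3 (Matrix.mulVecLin (jordanS 6)) - LinearMap.id)) ≃+
        ((Fin 3 → ℤ) × ZMod 2)) := by
  set N := LinearMap.range (extPowMap 3 (Matrix.mulVecLin (jordanS 6)) - LinearMap.id)
  let g : (Fin 6 → ℤ) [⋀^Fin 3]→ₗ[ℤ] ((⋀[ℤ]^3 (Fin 6 → ℤ)) ⧸ N) :=
    N.mkQ.compAlternatingMap (exteriorPower.ιMulti ℤ 3)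
  have hg (v) : g (fun t => (jordanS 6).mulVec (v t)) = g v := by
    refine (Submodule.Quotient.eq N).2 ⟨exteriorPower.ιMulti ℤ 3 v, ?_⟩
    rw [LinearMap.sub_apply, extPowMap_ιMulti]
    rfl
  let q : ((⋀[ℤ]^3 (Fin 6 → ℤ)) ⧸ N) →ₗ[ℤ] (Fin 3 → ℤ) × ZMod 2 :=
    N.liftQ formsMap range_le_ker_formsMap
  have hq (v) : q (g v) = (fun l => freeForm l v, (torsionForm v : ZMod 2)) := formsMap_ιMulti v
  let T : ZMod 2 →+ ((⋀[ℤ]^3 (Fin 6 → ℤ)) ⧸ N) :=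
    ZMod.lift 2 ⟨zmultiplesHom _ (onStd g 1 3 6), (onStd_values hg).1⟩
  have hT (z : ℤ) : T z = z • onStd g 1 3 6 := by simp [T]
  let r : (Fin 3 → ℤ) × ZMod 2 →ₗ[ℤ] ((⋀[ℤ]^3 (Fin 6 → ℤ)) ⧸ N) :=
    (Fintype.linearCombination ℤ ![onStd g 3 4 6, onStd g 3 5 6, onStd g 4 5 6]).coprod
      T.toIntLinearMap
  have hrq : r ∘ₗ q = LinearMap.id := by
    ext1
    ext1
    ext1 v
    change r (q (g v)) = g v
    rw [hq, eq_forms_of_invariant hg v]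
    simp [r, Fintype.linearCombination_apply, Fin.sum_univ_three, hT]
  have hqr (x) : q (r x) = x := by
    obtain ⟨a, z⟩ := x
    obtain ⟨z, rfl⟩ := ZMod.intCast_surjective z
    simp only [r, LinearMap.coprod_apply, Fintype.linearCombination_apply, Fin.sum_univ_three,
      AddMonoidHom.coe_toIntLinearMap, hT, onStd, map_add, map_smul, hq, Matrix.cons_val]
    ext l
    · fin_cases l <;> simp [freeForm, minorMap_apply, stdVec]
    · simp [torsionForm, minorMap_apply, stdVec]
  exact ⟨{ q.toAddMonoidHom with
    invFun := r
    left_inv := DFunLike.congr_fun hrq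
    right_inv := hqr }⟩
end
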